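/- (Linear-term bound in the weighted bootstrap norm, L^p version.) Fix 2 < p < ∞ and let p' = p/(p−1). There is a constant C (depending only on p and the Littlewood–Paley bump φ) such that for all Schwartz functions u₀, u₁ on ℝ³, ( Σ_{N∈2^ℤ} [ sup_{t ∈ [0,∞)} (⟨tN⟩/N)^{1−2/p} ‖ P_N( cos(t|∇|) u₀ + (sin(t|∇|)/|∇|) u₁ ) ‖_{L^p(ℝ³)} ]² )^{1/2} ≤ C [ ‖|∇|^{2−4/p} u₀‖_{L^{p'}(ℝ³)} + ‖|∇|^{1−4/p} u₁‖_{L^{p'}(ℝ³)} ]. -/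

import Mathlib

open MeasureTheory SchwartzMap Metric Set
open scoped ENNReal NNReal FourierTransform RealInnerProductSpace

noncomputable section

abbrev E3 := EuclideanSpace ℝ (Fin 3)

/-- Fourier multiplier with symbol `m`. -/
def fmul3 (m : E3 → ℂ) (f : E3 → ℂ) : E3 → ℂ :=
  𝓕⁻ (fun ξ => m ξ * 𝓕 f ξ)

/-- The fractional derivative `|∇|^s`. -/
def absGrad3 (s : ℝ) (f : E3 → ℂ) : E3 → ℂ :=
  fmul3 (fun ξ => (((2 * Real.pi * ‖ξ‖) ^ s : ℝ) : ℂ)) f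

/-- The half-wave propagator `e^{σ i t |∇|}`. -/
def halfWave3 (σ t : ℝ) (f : E3 → ℂ) : E3 → ℂ :=
  fmul3 (fun ξ => Complex.exp (Complex.I * (σ * (2 * Real.pi * t * ‖ξ‖)))) f

/-- The propagator `cos(t|∇|)`. -/
def cosProp3 (t : ℝ) (f : E3 → ℂ) : E3 → ℂ :=
  fmul3 (fun ξ => ((Real.cos (2 * Real.pi * t * ‖ξ‖) : ℝ) : ℂ)) f

/-- The propagator `sin(t|∇|)/|∇|`. -/
def sinProp3 (t : ℝ) (g : E3 → ℂ) : E3 → ℂ :=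
  fmul3 (fun ξ => ((Real.sin (2 * Real.pi * t * ‖ξ‖) / (2 * Real.pi * ‖ξ‖) : ℝ) : ℂ)) g

/-- A Littlewood–Paley bump function. -/
structure IsLPBump3 (φ : E3 → ℝ) : Prop where
  smooth : ContDiff ℝ (⊤ : ℕ∞) φ
  mem_Icc : ∀ ξ, φ ξ ∈ Icc (0:ℝ) 1
  eq_one : ∀ ξ : E3, ‖ξ‖ ≤ 1 → φ ξ = 1
  eq_zero : ∀ ξ : E3, 2 ≤ ‖ξ‖ → φ ξ = 0

/-- The Littlewood–Paley projection `P_N`. -/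
def LP3 (φ : E3 → ℝ) (N : ℝ) (f : E3 → ℂ) : E3 → ℂ :=
  fmul3 (fun ξ => ((φ (N⁻¹ • ξ) - φ ((2 / N) • ξ) : ℝ) : ℂ)) f

/-- The homogeneous Besov norm `Ḃ^s_{p,1}`. -/
def besov3 (φ : E3 → ℝ) (s : ℝ) (p : ℝ≥0∞) (f : E3 → ℂ) : ℝ≥0∞ :=
  ∑' n : ℤ, ENNReal.ofReal (((2:ℝ) ^ n) ^ s) * eLpNorm (LP3 φ ((2:ℝ) ^ n) f) p volume

/-- The mixed spacetime norm `L_t^p L_x^q (J × ℝ³)`. -/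
def mixedNorm3 (p q : ℝ≥0∞) (J : Set ℝ) (F : ℝ → E3 → ℂ) : ℝ≥0∞ :=
  if p = ∞ then essSup (fun t => eLpNorm (F t) q volume) (volume.restrict J)
  else (∫⁻ t in J, (eLpNorm (F t) q volume) ^ p.toReal) ^ (1 / p.toReal)

/-- Time derivative `∂ₜ u`. -/
def dt (u : ℝ → E3 → ℝ) (t : ℝ) (x : E3) : ℝ := deriv (fun s => u s x) t

/-- Second time derivative `∂ₜ² u`. -/
def dtt (u : ℝ → E3 → ℝ) (t : ℝ) (x : E3) : ℝ := deriv (fun s => dt u s x) t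

/-- The spatial Laplacian: sum of second partial derivatives. -/
def lap3 (f : E3 → ℝ) (x : E3) : ℝ :=
  ∑ i : Fin 3,
    fderiv ℝ (fun y => fderiv ℝ f y (EuclideanSpace.single i (1:ℝ))) x
      (EuclideanSpace.single i (1:ℝ))

/-- A Schwartz solution of the energy-critical NLW `∂ₜ²u - Δu + ε u⁵ = 0` on `ℝ × ℝ³`:
a jointly smooth function, all of whose time derivatives are Schwartz in space at each time,
solving the equation pointwise. -/
structure IsNLWSolution (ε : ℝ) (u : ℝ → E3 → ℝ) : Prop where
  smooth : ContDiff ℝ (⊤ : ℕ∞) (fun p : ℝ × E3 => u p.1 p.2)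
  schwartz : ∀ (k : ℕ) (t : ℝ), ∃ g : 𝓢(E3, ℝ), ∀ x,
    iteratedDeriv k (fun s => u s x) t = g x
  eqn : ∀ t x, dtt u t x - lap3 (u t) x + ε * (u t x) ^ 5 = 0

/-- `‖∇f‖_{L²}`. -/
def gradL2 (f : E3 → ℝ) : ℝ≥0∞ := eLpNorm (fun x => ‖fderiv ℝ f x‖) 2 volume

/-- `‖(f,g)‖_{Ḣ¹ × L²} = ‖∇f‖_{L²} + ‖g‖_{L²}`. -/
def H1L2 (f g : E3 → ℝ) : ℝ≥0∞ := gradL2 f + eLpNorm g 2 volume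

/-- The ground state `W(x) = (1 + |x|²/3)^{-1/2}`. -/
def Wfn : E3 → ℝ := fun x => (1 + ‖x‖ ^ 2 / 3) ^ (-(1/2) : ℝ)

/-- The (focusing-sign) energy `E(f,g) = ∫ ½|∇f|² + ½g² - ⅙f⁶`. -/
def energyKM (f g : E3 → ℝ) : ℝ :=
  ∫ x, ((1/2) * ‖fderiv ℝ f x‖ ^ 2 + (1/2) * g x ^ 2 - (1/6) * f x ^ 6)

/-- The Kenig–Merle condition: `E(u₀,u₁) < E(W,0)` and `‖∇u₀‖₂ < ‖∇W‖₂`. -/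
def KenigMerle (f g : E3 → ℝ) : Prop :=
  energyKM f g < energyKM Wfn (fun _ => 0) ∧ gradL2 f < gradL2 Wfn

/-- Coercion of a real-valued function to a complex-valued one. -/
def rc (f : E3 → ℝ) : E3 → ℂ := fun x => (f x : ℂ)

/-- Bounded, measurable, integrable functions. -/
structure BddInt (f : E3 → ℂ) : Prop where
  measurable : Measurable f
  integrable : Integrable f
  bounded : ∃ C, ∀ x, ‖f x‖ ≤ C

lemma BddInt.indicator {f : E3 → ℂ} (hf : BddInt f) {s : Set E3} (hs : MeasurableSet s) :
    BddInt (s.indicator f) where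
  measurable := hf.measurable.indicator hs
  integrable := hf.integrable.indicator hs
  bounded := by
    obtain ⟨C, hC⟩ := hf.bounded
    exact ⟨C, fun x => (norm_indicator_le_norm_self f x).trans (hC x)⟩

lemma BddInt.integrable_norm_rpow {f : E3 → ℂ} (hf : BddInt f) {q : ℝ} (hq : 1 ≤ q) :
    Integrable (fun x => ‖f x‖ ^ q) := by
  obtain ⟨C, hC⟩ := hf.bounded
  have hC0 : 0 ≤ C := (norm_nonneg _).trans (hC 0)
  refine (hf.integrable.norm.const_mul (C ^ (q - 1))).mono'
    (hf.measurable.norm.pow_const q).aestronglyMeasurable (Filter.Eventually.of_forall fun x => ?_)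
  rw [Real.norm_of_nonneg (by positivity)]
  calc ‖f x‖ ^ q = ‖f x‖ ^ (q - 1 + 1) := by ring_nf
    _ = ‖f x‖ ^ (q - 1) * ‖f x‖ := by
        rw [Real.rpow_add_one' (norm_nonneg _) (by linarith)]
    _ ≤ C ^ (q - 1) * ‖f x‖ := by
        gcongr
        exact hC x

lemma lintegral_Ioi_rpow_indicator {p R : ℝ} (hp : 2 < p) (hR : 0 ≤ R) :
    ∫⁻ t in Ioi (0 : ℝ), (Iic R).indicator (fun t => ENNReal.ofReal (t ^ (p - 3))) t
      = ENNReal.ofReal (R ^ (p - 2) / (p - 2)) := by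
  rw [lintegral_indicator measurableSet_Iic, Measure.restrict_restrict measurableSet_Iic,
    Set.inter_comm, Set.Ioi_inter_Iic]
  rw [← ofReal_integral_eq_lintegral_ofReal]
  · rw [← intervalIntegral.integral_of_le hR, integral_rpow (Or.inl (by linarith)),
      Real.zero_rpow (by linarith)]
    congr 2 <;> ring_nf
  · have := (intervalIntegral.intervalIntegrable_rpow' (a := 0) (b := R) (r := p - 3) (by linarith))
    rwa [intervalIntegrable_iff_integrableOn_Ioc_of_le hR] at this
  · filter_upwards [ae_restrict_mem measurableSet_Ioc] with t ht
    exact Real.rpow_nonneg ht.1.le _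

/-- Off-diagonal real interpolation between `L¹ → L^∞` and `L² → L²`. -/
theorem lintegral_rpow_le_of_L1_L2 {p q A B : ℝ} (hp : 2 < p) (hq : q = p / (p - 1))
    (hB : 0 < B) (T : (E3 → ℂ) → E3 → ℂ)
    (hT : ∀ f, BddInt f → Measurable (T f))
    (hadd : ∀ f g, BddInt f → BddInt g → ∀ x, ‖T (f + g) x‖ ≤ ‖T f x‖ + ‖T g x‖)
    (h1 : ∀ f, BddInt f → ∀ x, ‖T f x‖ ≤ B * ∫ y, ‖f y‖)
    (h2 : ∀ f, BddInt f → ∫⁻ x, ‖T f x‖ₑ ^ 2 ≤ ENNReal.ofReal (A ^ 2) * ∫⁻ x, ‖f x‖ₑ ^ 2)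
    (f : E3 → ℂ) (hf : BddInt f) :
    ∫⁻ x, ENNReal.ofReal (‖T f x‖ ^ p) ≤
      ENNReal.ofReal (4 * p / (p - 2) * A ^ 2 * (2 * B) ^ (p - 2)
        * (∫ x, ‖f x‖ ^ q) ^ (p - 1)) := by
  have hp1 : 0 < p - 1 := by linarith
  have hq1 : 1 < q := by rw [hq, lt_div_iff₀ hp1]; linarith
  have hqi := hf.integrable_norm_rpow hq1.le
  have hfn : Measurable fun x => ‖f x‖ := hf.measurable.norm
  set M := ∫ x, ‖f x‖ ^ q with hM
  have hM0 : 0 ≤ M := integral_nonneg fun x => by positivity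
  rcases hM0.eq_or_lt with hM0 | hMpos
  · have hz : (fun x => ‖f x‖ ^ q) =ᵐ[volume] 0 :=
      (integral_eq_zero_iff_of_nonneg (fun x => by positivity) hqi).1 hM0.symm
    have hz' : ∫ y, ‖f y‖ = 0 := by
      rw [integral_eq_zero_iff_of_nonneg (fun x => norm_nonneg _) hf.integrable.norm]
      filter_upwards [hz] with x hx
      have := (Real.rpow_eq_zero (norm_nonneg (f x)) (by linarith)).1 hx
      simpa using this
    have hTz : ∀ x, ‖T f x‖ = 0 := fun x =>
      le_antisymm ((h1 f hf x).trans (by rw [hz', mul_zero])) (norm_nonneg _)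
    simp [hTz, Real.zero_rpow (by linarith : p ≠ 0)]
  have hTm : Measurable fun x => ‖T f x‖ := (hT f hf).norm
  rw [lintegral_rpow_eq_lintegral_meas_lt_mul volume
    (Filter.Eventually.of_forall fun x => norm_nonneg _) hTm.aemeasurable (by linarith)]
  have key : ∀ t ∈ Ioi (0 : ℝ), volume {x | t < ‖T f x‖} * ENNReal.ofReal (t ^ (p - 1)) ≤
      ∫⁻ x, ENNReal.ofReal (4 * A ^ 2 * ‖f x‖ ^ 2) *
        {x | t * ‖f x‖ ^ (q - 1) ≤ 2 * B * M}.indicator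
          (fun _ => ENNReal.ofReal (t ^ (p - 3))) x := by
    intro t ht
    have ht : 0 < t := ht
    set G := {x | t * ‖f x‖ ^ (q - 1) ≤ 2 * B * M} with hG
    have hGm : MeasurableSet G :=
      measurableSet_le ((hfn.pow_const _).const_mul t) measurable_const
    have hsmall : ∀ x, ‖T (Gᶜ.indicator f) x‖ ≤ t / 2 := by
      intro x
      refine (h1 _ (hf.indicator hGm.compl) x).trans ?_
      have : ∫ y, ‖Gᶜ.indicator f y‖ ≤ ∫ y, t / (2 * B * M) * ‖f y‖ ^ q := by
        refine integral_mono (hf.indicator hGm.compl).integrable.norm (hqi.const_mul _) fun y => ?_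
        by_cases hy : y ∈ G
        · simp only [mem_compl_iff, hy, not_true_eq_false, not_false_eq_true,
            indicator_of_notMem, norm_zero]
          positivity
        · simp only [mem_compl_iff, hy, not_false_eq_true, indicator_of_mem]
          have hy' : 2 * B * M ≤ t * ‖f y‖ ^ (q - 1) := by
            simp only [hG, mem_ofPred_eq, not_le] at hy; exact hy.le
          rw [div_mul_eq_mul_div, le_div_iff₀ (by positivity)]
          calc ‖f y‖ * (2 * B * M) ≤ ‖f y‖ * (t * ‖f y‖ ^ (q - 1)) := by gcongr
            _ = t * (‖f y‖ ^ (q - 1) * ‖f y‖) := by ring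
            _ = t * ‖f y‖ ^ q := by
              rw [← Real.rpow_add_one' (norm_nonneg _) (by linarith)]; ring_nf
      rw [integral_const_mul, ← hM] at this
      calc B * ∫ y, ‖Gᶜ.indicator f y‖ ≤ B * (t / (2 * B * M) * M) := by gcongr
        _ = t / 2 := by field_simp
    have hbig : {x | t < ‖T f x‖} ⊆ {x | ENNReal.ofReal (t ^ 2 / 4) ≤
        ‖T (G.indicator f) x‖ₑ ^ 2} := by
      intro x hx
      have hx : t < ‖T f x‖ := hx
      have h := hadd _ _ (hf.indicator hGm.compl) (hf.indicator hGm) x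
      rw [Set.indicator_compl_add_self] at h
      have h' : t / 2 ≤ ‖T (G.indicator f) x‖ := by linarith [hsmall x]
      rw [mem_ofPred_eq, ← ofReal_norm, ← ENNReal.ofReal_pow (norm_nonneg _)]
      apply ENNReal.ofReal_le_ofReal
      nlinarith
    have hcheb : volume {x | t < ‖T f x‖} ≤
        (ENNReal.ofReal (A ^ 2) * ∫⁻ x, ‖G.indicator f x‖ₑ ^ 2) / ENNReal.ofReal (t ^ 2 / 4) := by
      refine (measure_mono hbig).trans ((meas_ge_le_lintegral_div ?_ ?_ ?_).trans ?_)
      · exact ((hT _ (hf.indicator hGm)).enorm.pow_const 2).aemeasurable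
      · simpa using by positivity
      · simp
      · gcongr
        exact h2 _ (hf.indicator hGm)
    calc _ ≤ (ENNReal.ofReal (A ^ 2) * ∫⁻ x, ‖G.indicator f x‖ₑ ^ 2) / ENNReal.ofReal (t ^ 2 / 4)
          * ENNReal.ofReal (t ^ (p - 1)) := by gcongr
      _ = ENNReal.ofReal (4 * A ^ 2 * t ^ (p - 3)) * ∫⁻ x, ‖G.indicator f x‖ₑ ^ 2 := by
        have e : ENNReal.ofReal (4 * A ^ 2 * t ^ (p - 3)) =
            ENNReal.ofReal (A ^ 2) * (ENNReal.ofReal (t ^ 2 / 4))⁻¹ *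
              ENNReal.ofReal (t ^ (p - 1)) := by
          rw [← ENNReal.ofReal_inv_of_pos (by positivity), ← ENNReal.ofReal_mul (by positivity),
            ← ENNReal.ofReal_mul (by positivity)]
          congr 1
          have : t ^ (p - 1) = t ^ (p - 3) * t ^ 2 := by
            rw [← Real.rpow_natCast, ← Real.rpow_add ht]; norm_num; ring_nf
          rw [this]; field_simp
        rw [e, ENNReal.div_eq_inv_mul]; ring
      _ = _ := by
        rw [← lintegral_const_mul _ (by
          exact ((hf.indicator hGm).measurable.enorm.pow_const 2))]
        refine lintegral_congr fun x => ?_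
        by_cases hx : x ∈ G
        · simp only [hx, indicator_of_mem]
          rw [← ofReal_norm, ← ENNReal.ofReal_pow (norm_nonneg _),
            ← ENNReal.ofReal_mul (by positivity), ← ENNReal.ofReal_mul (by positivity)]
          congr 1; ring
        · simp [hx]
  have hmeas : Measurable fun z : ℝ × E3 => ENNReal.ofReal (4 * A ^ 2 * ‖f z.2‖ ^ 2) *
        {x | z.1 * ‖f x‖ ^ (q - 1) ≤ 2 * B * M}.indicator
          (fun _ => ENNReal.ofReal (z.1 ^ (p - 3))) z.2 := by
    have hS : MeasurableSet {z : ℝ × E3 | z.1 * ‖f z.2‖ ^ (q - 1) ≤ 2 * B * M} :=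
      measurableSet_le (measurable_fst.mul ((hfn.comp measurable_snd).pow_const _))
        measurable_const
    have := (Measurable.indicator (s := {z : ℝ × E3 | z.1 * ‖f z.2‖ ^ (q - 1) ≤ 2 * B * M})
      (f := fun z : ℝ × E3 => ENNReal.ofReal (z.1 ^ (p - 3))) (by fun_prop) hS)
    exact (((((hfn.comp measurable_snd).pow_const 2).const_mul _).ennreal_ofReal).mul this)
  calc _ ≤ ENNReal.ofReal p * ∫⁻ t in Ioi (0 : ℝ),
        ∫⁻ x, ENNReal.ofReal (4 * A ^ 2 * ‖f x‖ ^ 2) *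
        {x | t * ‖f x‖ ^ (q - 1) ≤ 2 * B * M}.indicator
          (fun _ => ENNReal.ofReal (t ^ (p - 3))) x := by
        gcongr 1
        exact setLIntegral_mono' measurableSet_Ioi key
    _ = ENNReal.ofReal p * ∫⁻ x, ∫⁻ t in Ioi (0 : ℝ), ENNReal.ofReal (4 * A ^ 2 * ‖f x‖ ^ 2) *
        {x | t * ‖f x‖ ^ (q - 1) ≤ 2 * B * M}.indicator
          (fun _ => ENNReal.ofReal (t ^ (p - 3))) x := by
        rw [lintegral_lintegral_swap hmeas.aemeasurable]
    _ = ENNReal.ofReal p * ∫⁻ x, ENNReal.ofReal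
          (4 * A ^ 2 * (2 * B * M) ^ (p - 2) / (p - 2) * ‖f x‖ ^ q) := by
        congr 1
        refine lintegral_congr fun x => ?_
        rcases (norm_nonneg (f x)).eq_or_lt with h0 | hpos
        · rw [← h0, Real.zero_rpow (by linarith : q ≠ 0)]; simp
        have hset : ∀ t : ℝ, {x | t * ‖f x‖ ^ (q - 1) ≤ 2 * B * M}.indicator
            (fun _ => ENNReal.ofReal (t ^ (p - 3))) x =
            (Iic (2 * B * M * ‖f x‖ ^ (1 - q))).indicator
              (fun t => ENNReal.ofReal (t ^ (p - 3))) t := by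
          intro t
          have hiff : t * ‖f x‖ ^ (q - 1) ≤ 2 * B * M ↔ t ≤ 2 * B * M * ‖f x‖ ^ (1 - q) := by
            rw [← neg_sub q 1, Real.rpow_neg hpos.le, ← div_eq_mul_inv,
              le_div_iff₀ (Real.rpow_pos_of_pos hpos _)]
          simp only [indicator, mem_ofPred_eq, mem_Iic, hiff]
        simp_rw [hset]
        rw [lintegral_const_mul' _ _ ENNReal.ofReal_ne_top,
          lintegral_Ioi_rpow_indicator hp (by positivity), ← ENNReal.ofReal_mul (by positivity)]
        congr 1
        rw [Real.mul_rpow (by positivity) (by positivity), ← Real.rpow_mul hpos.le]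
        have e : ‖f x‖ ^ q = ‖f x‖ ^ 2 * ‖f x‖ ^ ((1 - q) * (p - 2)) := by
          rw [← Real.rpow_natCast, ← Real.rpow_add hpos]
          congr 1
          rw [hq]; push_cast; field_simp; ring
        rw [e]; ring
    _ = ENNReal.ofReal p * ENNReal.ofReal (4 * A ^ 2 * (2 * B * M) ^ (p - 2) / (p - 2) * M) := by
        rw [← ofReal_integral_eq_lintegral_ofReal (hqi.const_mul _)
          (Filter.Eventually.of_forall fun x => by
            have : 0 < p - 2 := by linarith
            positivity), integral_const_mul]
    _ = _ := by
        rw [← ENNReal.ofReal_mul (by linarith)]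
        congr 1
        rw [Real.mul_rpow (by positivity) hMpos.le]
        have : M ^ (p - 1) = M ^ (p - 2) * M := by
          rw [← Real.rpow_add_one hMpos.ne']; ring_nf
        rw [this]; ring

lemma exists_oscillatory_bound {b : ℝ → ℝ} (hb : ContDiff ℝ 1 b) {R : ℝ} (hR : 0 < R)
    (hbR : b R = 0) :
    ∃ C, 0 ≤ C ∧ ∀ t θ r : ℝ, 0 ≤ t → r ∈ Icc 0 R →
      |∫ u in R..r, b u * Real.cos (2 * Real.pi * t * u + θ)| ≤ C / (1 + t) := by
  obtain ⟨M₀, hM₀⟩ := (isCompact_Icc (a := (0:ℝ)) (b := R)).exists_bound_of_continuousOn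
    hb.continuous.continuousOn
  have hdb : Continuous (deriv b) := hb.continuous_deriv le_rfl
  obtain ⟨M₁, hM₁⟩ := (isCompact_Icc (a := (0:ℝ)) (b := R)).exists_bound_of_continuousOn
    hdb.continuousOn
  have hM₀0 : 0 ≤ M₀ := (norm_nonneg _).trans (hM₀ 0 ⟨le_rfl, hR.le⟩)
  have hM₁0 : 0 ≤ M₁ := (norm_nonneg _).trans (hM₁ 0 ⟨le_rfl, hR.le⟩)
  have htriv : ∀ t θ r : ℝ, r ∈ Icc 0 R →
      |∫ u in R..r, b u * Real.cos (2 * Real.pi * t * u + θ)| ≤ M₀ * R := by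
    intro t θ r hr
    rw [← Real.norm_eq_abs]
    refine (intervalIntegral.norm_integral_le_of_norm_le_const (C := M₀) fun u hu => ?_).trans ?_
    · have hu' : u ∈ Icc 0 R := by
        rw [uIoc_of_ge hr.2] at hu
        exact ⟨hr.1.trans hu.1.le, hu.2⟩
      rw [norm_mul]
      exact (mul_le_of_le_one_right (norm_nonneg _) (Real.abs_cos_le_one _)).trans (hM₀ u hu')
    · gcongr
      rw [abs_le]; constructor <;> linarith [hr.1, hr.2]
  have hibp : ∀ t θ r : ℝ, 0 < t → r ∈ Icc 0 R →
      |∫ u in R..r, b u * Real.cos (2 * Real.pi * t * u + θ)| * t ≤ M₀ + M₁ * R := by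
    intro t θ r ht hr
    have hc : 0 < 2 * Real.pi * t := by positivity
    have hv : ∀ u, HasDerivAt (fun u => Real.sin (2 * Real.pi * t * u + θ) / (2 * Real.pi * t))
        (Real.cos (2 * Real.pi * t * u + θ)) u := by
      intro u
      have h := ((((hasDerivAt_id u).const_mul (2 * Real.pi * t)).add_const θ).sin).div_const
        (2 * Real.pi * t)
      refine h.congr_deriv ?_
      simp only [id, mul_one]
      rw [mul_div_assoc, div_self hc.ne', mul_one]
    rw [intervalIntegral.integral_mul_deriv_eq_deriv_mul
      (fun u _ => (hb.differentiable one_ne_zero u).hasDerivAt) (fun u _ => hv u)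
      (hdb.intervalIntegrable _ _) (Continuous.intervalIntegrable (by fun_prop) _ _), hbR]
    have hsin : ∀ u, |Real.sin (2 * Real.pi * t * u + θ) / (2 * Real.pi * t)| ≤ 1 / t := by
      intro u
      rw [abs_div, abs_of_pos hc]
      refine div_le_div₀ zero_le_one (Real.abs_sin_le_one _) ht ?_
      nlinarith [Real.pi_gt_three]
    have h2 : |∫ u in R..r, deriv b u * (Real.sin (2 * Real.pi * t * u + θ) / (2 * Real.pi * t))|
        ≤ M₁ * (1 / t) * R := by
      rw [← Real.norm_eq_abs]
      refine (intervalIntegral.norm_integral_le_of_norm_le_const (C := M₁ * (1 / t))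
        fun u hu => ?_).trans ?_
      · have hu' : u ∈ Icc 0 R := by
          rw [uIoc_of_ge hr.2] at hu
          exact ⟨hr.1.trans hu.1.le, hu.2⟩
        rw [norm_mul]
        exact mul_le_mul (hM₁ u hu') (hsin u) (norm_nonneg _) hM₁0
      · gcongr
        rw [abs_le]; constructor <;> linarith [hr.1, hr.2]
    have h1 : |b r * (Real.sin (2 * Real.pi * t * r + θ) / (2 * Real.pi * t))| ≤ M₀ * (1 / t) := by
      rw [abs_mul]
      exact mul_le_mul (hM₀ r hr) (hsin r) (abs_nonneg _) hM₀0
    rw [zero_mul, sub_zero]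
    calc _ ≤ (M₀ * (1 / t) + M₁ * (1 / t) * R) * t := by
          gcongr
          exact (abs_sub _ _).trans (add_le_add h1 h2)
      _ = _ := by field_simp
  refine ⟨M₀ * R + (M₀ + M₁ * R), by positivity, fun t θ r ht hr => ?_⟩
  rw [le_div_iff₀ (by positivity), mul_add, mul_one]
  refine add_le_add (htriv t θ r hr) ?_
  rcases ht.eq_or_lt with rfl | ht
  · rw [mul_zero]; positivity
  · exact hibp t θ r ht hr

/-- The integral over a plane at height `s` of a radial function. -/
lemma integral_plane_radial {b : ℝ → ℝ} (hb : Continuous b) {R : ℝ} (hR : 0 < R)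
    (hbR : ∀ r, R ≤ r → b r = 0) {G : ℝ → ℝ} (hG : Continuous G) (hbG : ∀ r, b r = r * G r)
    {s : ℝ} (hs : s ≠ 0) :
    ∫ y : EuclideanSpace ℝ (Fin 2), G (√(s ^ 2 + ‖y‖ ^ 2)) =
      -(2 * volume.real (ball (0 : EuclideanSpace ℝ (Fin 2)) 1)) * ∫ u in R..|s|, b u := by
  rw [integral_fun_norm_addHaar volume (fun r => G (√(s ^ 2 + r ^ 2)))]
  simp only [finrank_euclideanSpace, Fintype.card_fin, Nat.add_one_sub_one, pow_one, smul_eq_mul,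
    nsmul_eq_mul, Nat.cast_ofNat]
  have hGR : ∀ r, R ≤ r → G r = 0 := fun r hr => by
    have := hbR r hr
    rw [hbG] at this
    exact (mul_eq_zero.1 this).resolve_left (hR.trans_le hr).ne'
  have hle : ∀ r : ℝ, r ≤ √(s ^ 2 + r ^ 2) := fun r =>
    Real.le_sqrt_of_sq_le (by nlinarith [sq_nonneg s])
  have hle' : ∀ r : ℝ, |r| ≤ √(s ^ 2 + r ^ 2) := fun r => by
    have := hle |r|
    rwa [sq_abs] at this
  have hderiv : ∀ ρ ∈ Ici (0 : ℝ), HasDerivAt (fun ρ => ∫ u in R..√(s ^ 2 + ρ ^ 2), b u)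
      (ρ * G (√(s ^ 2 + ρ ^ 2))) ρ := by
    intro ρ _
    have hpos : 0 < s ^ 2 + ρ ^ 2 := by positivity
    have h1 : HasDerivAt (fun ρ : ℝ => √(s ^ 2 + ρ ^ 2)) (ρ / √(s ^ 2 + ρ ^ 2)) ρ := by
      have := (((hasDerivAt_id ρ).pow 2).const_add (s ^ 2)).sqrt hpos.ne'
      refine this.congr_deriv ?_
      simp only [id, Nat.cast_ofNat, Nat.add_one_sub_one, pow_one, mul_one, Pi.pow_apply]
      rw [mul_div_mul_left _ _ two_ne_zero]
    have h2 : HasDerivAt (fun r => ∫ u in R..r, b u) (b (√(s ^ 2 + ρ ^ 2))) (√(s ^ 2 + ρ ^ 2)) :=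
      intervalIntegral.integral_hasDerivAt_right (hb.intervalIntegrable _ _)
        hb.stronglyMeasurable.stronglyMeasurableAtFilter hb.continuousAt
    have : √(s ^ 2 + ρ ^ 2) ≠ 0 := (Real.sqrt_pos.2 hpos).ne'
    have h4 : b (√(s ^ 2 + ρ ^ 2)) * (ρ / √(s ^ 2 + ρ ^ 2)) = ρ * G (√(s ^ 2 + ρ ^ 2)) := by
      rw [hbG]; field_simp
    exact (h2.comp ρ h1).congr_deriv h4
  have hint : IntegrableOn (fun ρ => ρ * G (√(s ^ 2 + ρ ^ 2))) (Ioi 0) := by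
    refine (Continuous.integrable_of_hasCompactSupport (by fun_prop) ?_).integrableOn
    refine HasCompactSupport.intro (isCompact_Icc (a := -R) (b := R)) fun ρ hρ => ?_
    have : R ≤ |ρ| := by
      by_contra h
      push Not at h
      exact hρ (abs_le.1 h.le)
    rw [hGR _ (this.trans (hle' ρ)), mul_zero]
  have htend : Filter.Tendsto (fun ρ => ∫ u in R..√(s ^ 2 + ρ ^ 2), b u) Filter.atTop
      (nhds 0) := by
    refine tendsto_const_nhds.congr' ?_
    filter_upwards [Filter.eventually_ge_atTop R] with ρ hρ
    symm
    refine intervalIntegral.integral_zero_ae (Filter.Eventually.of_forall fun u hu => ?_)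
    rw [uIoc_of_le (hρ.trans (hle ρ))] at hu
    exact hbR u hu.1.le
  rw [integral_Ioi_of_hasDerivAt_of_tendsto' hderiv hint htend]
  simp [Real.sqrt_sq_eq_abs]
  ring

lemma exists_orthonormalBasis_smul (x : E3) :
    ∃ b : OrthonormalBasis (Fin 3) ℝ E3, x = ‖x‖ • b 0 := by
  obtain ⟨u, hu, hxu⟩ : ∃ u : E3, ‖u‖ = 1 ∧ x = ‖x‖ • u := by
    rcases eq_or_ne x 0 with rfl | hx
    · exact ⟨EuclideanSpace.single 0 1, by simp, by simp⟩
    · have : ‖x‖ ≠ 0 := norm_ne_zero_iff.2 hx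
      refine ⟨‖x‖⁻¹ • x, ?_, ?_⟩
      · rw [norm_smul, norm_inv, norm_norm, inv_mul_cancel₀ this]
      · rw [smul_smul, mul_inv_cancel₀ this, one_smul]
  have hon : Orthonormal ℝ (({0} : Set (Fin 3)).domRestrict (fun _ => u)) := by
    constructor
    · intro i; exact hu
    · rintro ⟨i, hi⟩ ⟨j, hj⟩ hij
      simp only [mem_singleton_iff] at hi hj
      subst hi; subst hj
      exact (hij rfl).elim
  obtain ⟨b, hb⟩ := hon.exists_orthonormalBasis_extension_of_card_eq
    (by simp)
  exact ⟨b, by rw [hb 0 rfl]; exact hxu⟩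

lemma integral_slices (b : OrthonormalBasis (Fin 3) ℝ E3) {Φ : E3 → ℂ} (hΦ : Integrable Φ)
    {F : ℝ → EuclideanSpace ℝ (Fin 2) → ℂ}
    (hF : ∀ x : E3, ∀ y : EuclideanSpace ℝ (Fin 2), ‖x‖ ^ 2 = ⟪b 0, x⟫ ^ 2 + ‖y‖ ^ 2 →
      Φ x = F ⟪b 0, x⟫ y) :
    ∫ x, Φ x = ∫ s, ∫ y, F s y := by
  have m1 := b.measurePreserving_repr_symm
  have m2 := PiLp.volume_preserving_toLp (Fin 3)
  have m3 := (volume_preserving_piFinSuccAbove (fun _ : Fin 3 => ℝ) 0).symm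
  have m4 : MeasurePreserving (Prod.map (id : ℝ → ℝ) (@WithLp.ofLp 2 (Fin 2 → ℝ))) :=
    (MeasurePreserving.id volume).prod (PiLp.volume_preserving_ofLp (Fin 2))
  have m := ((m1.comp m2).comp m3).comp m4
  have e1 : MeasurableEmbedding b.repr.symm :=
    b.repr.symm.toHomeomorph.measurableEmbedding
  have e2 : MeasurableEmbedding (@WithLp.toLp 2 (Fin 3 → ℝ)) :=
    (MeasurableEquiv.toLp 2 (Fin 3 → ℝ)).measurableEmbedding
  have e3 := (MeasurableEquiv.piFinSuccAbove (fun _ : Fin 3 => ℝ) 0).symm.measurableEmbedding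
  have e4 : MeasurableEmbedding (Prod.map (id : ℝ → ℝ) (@WithLp.ofLp 2 (Fin 2 → ℝ))) :=
    ((MeasurableEquiv.refl ℝ).prodCongr
      (MeasurableEquiv.toLp 2 (Fin 2 → ℝ)).symm).measurableEmbedding
  have e := ((e1.comp e2).comp e3).comp e4
  rw [← m.integral_comp e]
  have hi := (m.integrable_comp_emb e).2 hΦ
  rw [Measure.volume_eq_prod] at hi ⊢
  refine (integral_prod _ hi).trans ?_
  congr 1; ext s; congr 1; ext y
  have hin : ⟪b 0, (((b.repr.symm ∘ WithLp.toLp 2) ∘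
      (MeasurableEquiv.piFinSuccAbove (fun _ : Fin 3 => ℝ) 0).symm) ∘
      Prod.map id WithLp.ofLp) (s, y)⟫ = s := by
    rw [← OrthonormalBasis.repr_apply_apply]
    simp
  rw [Function.comp_apply, hF _ y, hin]
  rw [hin]
  simp [EuclideanSpace.norm_sq_eq, Fin.sum_univ_succ]

/-- Decay of the Fourier transform of a radial oscillating symbol. -/
theorem exists_radial_fourierInv_bound {β : ℝ → ℝ} (hβ : ContDiff ℝ 1 β) {R : ℝ} (hR : 0 < R)
    (hβR : ∀ r, R ≤ r → β r = 0) :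
    ∃ C, 0 < C ∧ ∀ t θ : ℝ, 0 ≤ t → ∀ x : E3,
      ‖𝓕⁻ (fun ξ : E3 => ((β ‖ξ‖ * Real.cos (2 * Real.pi * t * ‖ξ‖ + θ) : ℝ) : ℂ)) x‖
        ≤ C / (1 + t) := by
  obtain ⟨C, hC0, hC⟩ := exists_oscillatory_bound (b := fun u => u * β u)
    (contDiff_id.mul hβ) hR (by simp [hβR R le_rfl])
  set V := 2 * volume.real (ball (0 : EuclideanSpace ℝ (Fin 2)) 1) with hV
  have hV0 : 0 ≤ V := by positivity
  refine ⟨V * C * (2 * R) + 1, by positivity, fun t θ ht x => ?_⟩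
  obtain ⟨e, he⟩ := exists_orthonormalBasis_smul x
  set G : ℝ → ℝ := fun r => β r * Real.cos (2 * Real.pi * t * r + θ) with hGdef
  have hG : Continuous G := by have := hβ.continuous; fun_prop
  have hGR : ∀ r, R ≤ r → G r = 0 := fun r hr => by simp [hGdef, hβR r hr]
  have hint : Integrable (fun ξ : E3 => Complex.exp ((2 * Real.pi * ⟪ξ, x⟫ : ℝ) * Complex.I) •
      ((G ‖ξ‖ : ℝ) : ℂ)) := by
    refine Continuous.integrable_of_hasCompactSupport (by fun_prop) ?_
    refine HasCompactSupport.intro (isCompact_closedBall (0 : E3) R) fun ξ hξ => ?_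
    have : R ≤ ‖ξ‖ := by
      by_contra h
      push Not at h
      exact hξ (by simpa using h.le)
    simp [hGR _ this]
  rw [Real.fourierInv_eq']
  rw [integral_slices e hint (F := fun s y =>
    Complex.exp ((2 * Real.pi * (‖x‖ * s) : ℝ) * Complex.I) • ((G (√(s ^ 2 + ‖y‖ ^ 2)) : ℝ) : ℂ))]
  · simp_rw [integral_smul, integral_complex_ofReal]
    have hb : ∀ᵐ s : ℝ, ‖Complex.exp ((2 * Real.pi * (‖x‖ * s) : ℝ) * Complex.I) •
        ((∫ y : EuclideanSpace ℝ (Fin 2), G (√(s ^ 2 + ‖y‖ ^ 2)) : ℝ) : ℂ)‖ ≤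
        (Icc (-R) R).indicator (fun _ => V * (C / (1 + t))) s := by
      have h0 : ∀ᵐ s : ℝ, s ≠ 0 := by
        simp [ae_iff]
      filter_upwards [h0] with s hs
      rw [norm_smul, Complex.norm_exp_ofReal_mul_I, one_mul, Complex.norm_real]
      by_cases hsR : s ∈ Icc (-R) R
      · rw [indicator_of_mem hsR, integral_plane_radial (b := fun r => r * G r) (by fun_prop) hR
          (fun r hr => by simp [hGR r hr]) hG (fun _ => rfl) hs, norm_mul, norm_neg,
          Real.norm_of_nonneg hV0]
        gcongr
        have := hC t θ |s| ht ⟨abs_nonneg _, abs_le.2 hsR⟩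
        rw [Real.norm_eq_abs]
        simpa only [hGdef, mul_assoc] using this
      · rw [indicator_of_notMem hsR]
        have hs' : R ≤ |s| := by
          by_contra h
          push Not at h
          exact hsR (abs_le.1 h.le)
        have : ∀ y : EuclideanSpace ℝ (Fin 2), G (√(s ^ 2 + ‖y‖ ^ 2)) = 0 := fun y => by
          apply hGR
          refine hs'.trans (Real.le_sqrt_of_sq_le ?_)
          rw [sq_abs]; nlinarith [sq_nonneg ‖y‖]
        simp [this]
    refine (norm_integral_le_of_norm_le ?_ hb).trans ?_
    · exact (integrable_indicator_iff measurableSet_Icc).2 (integrableOn_const (by simp))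
    · rw [integral_indicator measurableSet_Icc, setIntegral_const]
      simp only [Measure.real, Real.volume_Icc, smul_eq_mul]
      rw [ENNReal.toReal_ofReal (by linarith), le_div_iff₀ (by positivity)]
      have : (R - -R) * (V * (C / (1 + t))) * (1 + t) = V * C * (2 * R) := by
        field_simp; ring
      linarith
  · intro ξ y h
    rw [← h, Real.sqrt_sq (norm_nonneg _)]
    congr 4
    conv_lhs => rw [he]
    rw [real_inner_smul_right, real_inner_comm]

lemma continuous_fourierInv {g : E3 → ℂ} (hg : Integrable g) : Continuous (𝓕⁻ g) := by
  have := VectorFourier.fourierIntegral_continuous Real.continuous_fourierChar (μ := volume)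
    (L := innerₗ E3) continuous_inner hg
  rw [show 𝓕⁻ g = fun x => 𝓕 g (-x) from funext fun x => Real.fourierInv_eq_fourier_neg g x]
  exact this.comp continuous_neg

lemma integrable_prod_conv {K h : E3 → ℂ} (hK : Integrable K) (hh : Integrable h) :
    Integrable (fun z : E3 × E3 => K z.2 * h z.1) (volume.prod volume) := by
  simpa [mul_comm] using hh.mul_prod hK

/-- Convolution with the inverse Fourier transform of `m` is the Fourier multiplier `m`. -/
lemma integral_fourierInv_sub_mul {m h : E3 → ℂ} (hm : Integrable m) (hh : Integrable h) (x : E3) :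
    ∫ y, 𝓕⁻ m (x - y) * h y = 𝓕⁻ (fun ξ => m ξ * 𝓕 h ξ) x := by
  simp_rw [Real.fourierInv_eq', Real.fourier_eq', smul_eq_mul, ← integral_mul_const,
    ← integral_const_mul]
  rw [integral_integral_swap]
  · congr 1; ext ξ; congr 1; ext y
    have : Complex.exp (((2 * Real.pi * ⟪ξ, x - y⟫ : ℝ) : ℂ) * Complex.I) =
        Complex.exp (((2 * Real.pi * ⟪ξ, x⟫ : ℝ) : ℂ) * Complex.I) *
        Complex.exp (((-2 * Real.pi * ⟪y, ξ⟫ : ℝ) : ℂ) * Complex.I) := by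
      rw [← Complex.exp_add, inner_sub_right, real_inner_comm ξ y]
      congr 1; push_cast; ring
    rw [this]; ring
  · refine ((integrable_prod_conv hm hh).bdd_mul (c := 1)
      (f := fun z : E3 × E3 => Complex.exp (((2 * Real.pi * ⟪z.2, x - z.1⟫ : ℝ) : ℂ) * Complex.I))
      (Continuous.aestronglyMeasurable (by fun_prop)) ?_).congr ?_
    · exact Filter.Eventually.of_forall fun z => (Complex.norm_exp_ofReal_mul_I _).le
    · exact Filter.Eventually.of_forall fun z => by simp [Function.uncurry, mul_assoc]

lemma fourierInv_comp_smul (m : E3 → ℂ) {N : ℝ} (hN : 0 < N) (x : E3) :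
    𝓕⁻ (fun ξ => m (N⁻¹ • ξ)) x = ((N ^ 3 : ℝ) : ℂ) * 𝓕⁻ m (N • x) := by
  simp_rw [Real.fourierInv_eq', smul_eq_mul]
  have := Measure.integral_comp_inv_smul volume
    (fun ξ : E3 => Complex.exp (((2 * Real.pi * ⟪ξ, N • x⟫ : ℝ) : ℂ) * Complex.I) * m ξ) N
  simp only [finrank_euclideanSpace, Fintype.card_fin] at this
  rw [abs_of_pos (by positivity), Complex.real_smul] at this
  rw [← this]
  congr 1; ext ξ
  rw [real_inner_smul_left, real_inner_smul_right, inv_mul_cancel_left₀ hN.ne']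

lemma lintegral_enorm_sq_schwartz (f : 𝓢(E3, ℂ)) :
    ∫⁻ x, ‖f x‖ₑ ^ 2 = ENNReal.ofReal (∫ x, ‖f x‖ ^ 2) := by
  rw [ofReal_integral_eq_lintegral_ofReal]
  · congr 1; ext x
    rw [ENNReal.ofReal_pow (norm_nonneg _), ofReal_norm]
  · exact (f.memLp 2).integrable_norm_pow two_ne_zero
  · exact Filter.Eventually.of_forall fun _ => by positivity

/-- The product of two Schwartz functions. -/
def schwartzMul (f g : 𝓢(E3, ℂ)) : 𝓢(E3, ℂ) :=
  SchwartzMap.pairing (ContinuousLinearMap.mul ℂ ℂ) f g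

lemma schwartzMul_apply (f g : 𝓢(E3, ℂ)) (x : E3) : schwartzMul f g x = f x * g x := by
  simp [schwartzMul, SchwartzMap.pairing_apply_apply]

lemma fourierInv_mul_fourier_schwartz (m h : 𝓢(E3, ℂ)) :
    𝓕⁻ (fun ξ => m ξ * 𝓕 (h : E3 → ℂ) ξ) = (𝓕⁻ (schwartzMul m (𝓕 h)) : 𝓢(E3, ℂ)) := by
  rw [SchwartzMap.fourierInv_coe]
  exact congrArg _ (funext fun ξ => (schwartzMul_apply m (𝓕 h) ξ).symm)

lemma lintegral_multiplier_schwartz_le (m h : 𝓢(E3, ℂ)) {A : ℝ} (hA : ∀ ξ, ‖m ξ‖ ≤ A) :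
    ∫⁻ x, ‖∫ y, 𝓕⁻ (m : E3 → ℂ) (x - y) * h y‖ₑ ^ 2 ≤
      ENNReal.ofReal (A ^ 2) * ∫⁻ x, ‖h x‖ₑ ^ 2 := by
  simp_rw [integral_fourierInv_sub_mul m.integrable h.integrable]
  simp_rw [fourierInv_mul_fourier_schwartz]
  rw [lintegral_enorm_sq_schwartz, lintegral_enorm_sq_schwartz, ← ENNReal.ofReal_mul (sq_nonneg _),
    ← SchwartzMap.integral_norm_sq_fourier, FourierTransform.fourier_fourierInv_eq,
    ← SchwartzMap.integral_norm_sq_fourier h, ← integral_const_mul]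
  refine ENNReal.ofReal_le_ofReal (integral_mono ?_ ?_ fun ξ => ?_)
  · exact ((schwartzMul m (𝓕 h)).memLp 2).integrable_norm_pow two_ne_zero
  · exact (((𝓕 h).memLp 2).integrable_norm_pow two_ne_zero).const_mul _
  · simp only [schwartzMul_apply, norm_mul, mul_pow]
    gcongr
    exact hA ξ

lemma lintegral_enorm_sq (f : E3 → ℂ) : ∫⁻ x, ‖f x‖ₑ ^ 2 = eLpNorm f 2 ^ 2 := by
  have := eLpNorm_nnreal_pow_eq_lintegral (f := f) (μ := volume) (p := 2) two_ne_zero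
  simpa using this.symm

lemma BddInt.memLp_two {f : E3 → ℂ} (hf : BddInt f) : MemLp f 2 := by
  rw [memLp_two_iff_integrable_sq_norm hf.integrable.1]
  simpa using hf.integrable_norm_rpow (q := 2) one_le_two

lemma tendsto_conv_of_eLpNorm_two {K : E3 → ℂ} (hK2 : MemLp K 2) {h : E3 → ℂ} (hh : MemLp h 2)
    {g : ℕ → E3 → ℂ} (hg2 : ∀ k, MemLp (g k) 2)
    (hg : Filter.Tendsto (fun k => eLpNorm (h - g k) 2) Filter.atTop (nhds 0)) (x : E3) :
    Filter.Tendsto (fun k => ∫ y, K (x - y) * g k y) Filter.atTop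
      (nhds (∫ y, K (x - y) * h y)) := by
  have hKx : MemLp (fun y => K (x - y)) 2 :=
    hK2.comp_measurePreserving (Measure.measurePreserving_sub_left volume x)
  have hint : ∀ f : E3 → ℂ, MemLp f 2 → Integrable fun y => K (x - y) * f y := fun f hf =>
    hKx.integrable_mul hf
  rw [tendsto_iff_edist_tendsto_0]
  refine tendsto_of_tendsto_of_tendsto_of_le_of_le tendsto_const_nhds
    (h := fun k : ℕ => eLpNorm (fun y => K (x - y)) 2 * eLpNorm (h - g k) 2)
    ?_ (fun _ => zero_le) fun k => ?_
  · simpa using ENNReal.Tendsto.const_mul (b := 0) hg (Or.inr hKx.eLpNorm_ne_top)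
  · simp only
    rw [edist_comm, edist_eq_enorm_sub, ← integral_sub (hint _ hh) (hint _ (hg2 k))]
    refine (enorm_integral_le_lintegral_enorm _).trans ?_
    rw [← eLpNorm_one_eq_lintegral_enorm]
    have := eLpNorm_smul_le_mul_eLpNorm (p := 2) (q := 2) (r := 1) (hh.sub (hg2 k)).1 hKx.1
    refine le_trans (le_of_eq ?_) this
    congr 1; ext y
    simp [mul_sub]

lemma exists_schwartz_tendsto {h : E3 → ℂ} (hh : MemLp h 2) :
    ∃ g : ℕ → 𝓢(E3, ℂ),
      Filter.Tendsto (fun k => eLpNorm (h - ⇑(g k)) 2) Filter.atTop (nhds 0) := by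
  have happ : ∀ k : ℕ, ∃ g : 𝓢(E3, ℂ),
      eLpNorm (h - ⇑g) 2 ≤ ENNReal.ofReal (1 / ((k : ℝ) + 1)) := fun k => by
    obtain ⟨g, hg₁, hg₂, hg₃⟩ := MemLp.exist_eLpNorm_sub_le ENNReal.ofNat_ne_top one_le_two
      hh (ε := 1 / ((k : ℝ) + 1)) (by positivity)
    exact ⟨hg₁.toSchwartzMap hg₂, hg₃⟩
  choose g hg using happ
  have hε : Filter.Tendsto (fun k : ℕ => ENNReal.ofReal (1 / ((k : ℝ) + 1))) Filter.atTop
      (nhds 0) := by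
    simpa using ENNReal.tendsto_ofReal tendsto_one_div_add_atTop_nhds_zero_nat
  exact ⟨g, tendsto_of_tendsto_of_tendsto_of_le_of_le tendsto_const_nhds hε
    (fun _ => zero_le) hg⟩

lemma liminf_le_of_le_mul_add {a : ℝ} {c : ℝ≥0∞} {u e : ℕ → ℝ≥0∞}
    (he : Filter.Tendsto e Filter.atTop (nhds 0)) (hu : ∀ k, u k ≤ ENNReal.ofReal a * (c + e k)) :
    Filter.liminf u Filter.atTop ≤ ENNReal.ofReal a * c := by
  have h1 : Filter.Tendsto (fun k => c + e k) Filter.atTop (nhds c) := by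
    simpa using tendsto_const_nhds.add he
  have h2 := ENNReal.Tendsto.const_mul (a := ENNReal.ofReal a) h1
    (Or.inr ENNReal.ofReal_ne_top)
  rw [← h2.liminf_eq]
  exact Filter.liminf_le_liminf (Filter.Eventually.of_forall hu)

lemma lintegral_multiplier_le (m : 𝓢(E3, ℂ)) {A : ℝ} (hA : ∀ ξ, ‖m ξ‖ ≤ A)
    {h : E3 → ℂ} (hh : BddInt h) :
    ∫⁻ x, ‖∫ y, 𝓕⁻ (m : E3 → ℂ) (x - y) * h y‖ₑ ^ 2 ≤
      ENNReal.ofReal (A ^ 2) * ∫⁻ x, ‖h x‖ₑ ^ 2 := by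
  have hA0 : 0 ≤ A := (norm_nonneg _).trans (hA 0)
  have hK2 : MemLp (𝓕⁻ (m : E3 → ℂ)) 2 := by
    rw [← SchwartzMap.fourierInv_coe]; exact SchwartzMap.memLp (𝓕⁻ m : 𝓢(E3, ℂ)) 2 volume
  obtain ⟨g, hg⟩ := exists_schwartz_tendsto hh.memLp_two
  have hlim := tendsto_conv_of_eLpNorm_two hK2 hh.memLp_two (fun k => (g k).memLp 2) hg
  have hmeas : ∀ k, AEStronglyMeasurable (fun x => ∫ y, 𝓕⁻ (m : E3 → ℂ) (x - y) * g k y)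
      volume := fun k => by
    simp_rw [integral_fourierInv_sub_mul m.integrable (g k).integrable,
      fourierInv_mul_fourier_schwartz]
    exact (SchwartzMap.continuous _).aestronglyMeasurable
  have hk : ∀ k, eLpNorm (fun x => ∫ y, 𝓕⁻ (m : E3 → ℂ) (x - y) * g k y) 2 ≤
      ENNReal.ofReal A * (eLpNorm h 2 + eLpNorm (h - ⇑(g k)) 2) := fun k => by
    have h1 := lintegral_multiplier_schwartz_le m (g k) hA
    rw [lintegral_enorm_sq, lintegral_enorm_sq, ENNReal.ofReal_pow hA0, ← mul_pow,
      ENNReal.pow_le_pow_left_iff two_ne_zero] at h1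
    refine h1.trans ?_
    gcongr
    have : (g k : E3 → ℂ) = h - (h - ⇑(g k)) := by simp
    conv_lhs => rw [this]
    exact eLpNorm_sub_le hh.memLp_two.1 (hh.memLp_two.sub ((g k).memLp 2)).1 one_le_two
  generalize 𝓕⁻ (m : E3 → ℂ) = K at *
  have hfat := Lp.eLpNorm_lim_le_liminf_eLpNorm (p := 2) (μ := (volume : Measure E3))
    hmeas (fun x => ∫ y, K (x - y) * h y) (Filter.Eventually.of_forall hlim)
  rw [lintegral_enorm_sq, lintegral_enorm_sq, ENNReal.ofReal_pow hA0, ← mul_pow]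
  gcongr
  exact hfat.trans (liminf_le_of_le_mul_add hg hk)

/-- The radial oscillating symbol `β(|ξ|) cos(2πt|ξ| + θ)`. -/
def waveSymbol (β : ℝ → ℝ) (t θ : ℝ) (ξ : E3) : ℂ :=
  ((β ‖ξ‖ * Real.cos (2 * Real.pi * t * ‖ξ‖ + θ) : ℝ) : ℂ)

/-- A smooth function on the line supported in a compact subset of the positive reals. -/
structure AnnularBump (β : ℝ → ℝ) (a b : ℝ) : Prop where
  smooth : ContDiff ℝ (⊤ : ℕ∞) β
  pos : 0 < a
  pos' : 0 < b
  eq_zero_left : ∀ r, r ≤ a → β r = 0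
  eq_zero_right : ∀ r, b ≤ r → β r = 0

section

variable {β : ℝ → ℝ} {a b : ℝ}

lemma AnnularBump.contDiff_waveSymbol (hβ : AnnularBump β a b) (t θ : ℝ) :
    ContDiff ℝ (⊤ : ℕ∞) (waveSymbol β t θ) := by
  rw [contDiff_iff_contDiffAt]
  intro ξ
  rcases eq_or_ne ξ 0 with rfl | hξ
  · refine (contDiffAt_const (c := (0 : ℂ))).congr_of_eventuallyEq ?_
    filter_upwards [ball_mem_nhds (0 : E3) hβ.pos] with ξ hξ
    rw [mem_ball_zero_iff] at hξ
    simp [waveSymbol, hβ.eq_zero_left _ hξ.le]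
  · have hn : ContDiffAt ℝ (⊤ : ℕ∞) (fun ξ : E3 => ‖ξ‖) ξ := contDiffAt_norm ℝ hξ
    have h1 : ContDiffAt ℝ (⊤ : ℕ∞) (fun ξ : E3 => β ‖ξ‖) ξ :=
      hβ.smooth.contDiffAt.comp ξ hn
    have h2 : ContDiffAt ℝ (⊤ : ℕ∞)
        (fun ξ : E3 => Real.cos (2 * Real.pi * t * ‖ξ‖ + θ)) ξ :=
      ((contDiffAt_const.mul hn).add contDiffAt_const).cos
    exact Complex.ofRealCLM.contDiff.contDiffAt.comp ξ (h1.mul h2)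

lemma AnnularBump.hasCompactSupport_waveSymbol (hβ : AnnularBump β a b) (t θ : ℝ) :
    HasCompactSupport (waveSymbol β t θ) := by
  refine HasCompactSupport.intro (isCompact_closedBall (0 : E3) b) fun ξ hξ => ?_
  have : b ≤ ‖ξ‖ := by
    by_contra h
    push Not at h
    exact hξ (by simpa using h.le)
  simp [waveSymbol, hβ.eq_zero_right _ this]

lemma AnnularBump.exists_bound (hβ : AnnularBump β a b) :
    ∃ A, 0 < A ∧ ∀ t θ ξ, ‖waveSymbol β t θ ξ‖ ≤ A := by
  obtain ⟨A, hA⟩ := (isCompact_Icc (a := (0:ℝ)) (b := b)).exists_bound_of_continuousOn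
    hβ.smooth.continuous.continuousOn
  refine ⟨|A| + 1, by positivity, fun t θ ξ => ?_⟩
  rw [waveSymbol, Complex.norm_real, norm_mul]
  refine (mul_le_of_le_one_right (norm_nonneg _) (Real.abs_cos_le_one _)).trans ?_
  by_cases h : ‖ξ‖ ≤ b
  · linarith [hA ‖ξ‖ ⟨norm_nonneg _, h⟩, le_abs_self A]
  · rw [hβ.eq_zero_right _ (not_le.1 h).le, norm_zero]; positivity

/-- The interpolated dispersive estimate for a frequency-localised wave multiplier. -/
lemma AnnularBump.exists_lintegral_le (hβ : AnnularBump β a b) {p q : ℝ} (hp : 2 < p)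
    (hq : q = p / (p - 1)) :
    ∃ C, 0 < C ∧ ∀ N t θ : ℝ, 0 < N → 0 ≤ t → ∀ H : E3 → ℂ, BddInt H →
      ∫⁻ x, ENNReal.ofReal
          (‖𝓕⁻ (fun ξ => waveSymbol β (t * N) θ (N⁻¹ • ξ) * 𝓕 H ξ) x‖ ^ p) ≤
        ENNReal.ofReal (C * (N ^ 3 / (1 + t * N)) ^ (p - 2) * (∫ x, ‖H x‖ ^ q) ^ (p - 1)) := by
  have hp2 : 0 < p - 2 := by linarith
  obtain ⟨A, hA0, hA⟩ := hβ.exists_bound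
  obtain ⟨D, hD0, hD⟩ := exists_radial_fourierInv_bound
    (hβ.smooth.of_le (by exact_mod_cast le_top)) hβ.pos' hβ.eq_zero_right
  refine ⟨4 * p / (p - 2) * A ^ 2 * (2 * D) ^ (p - 2), by positivity, ?_⟩
  intro N t θ hN ht H hH
  have hsm : ContDiff ℝ (⊤ : ℕ∞) (fun ξ : E3 => waveSymbol β (t * N) θ (N⁻¹ • ξ)) :=
    (hβ.contDiff_waveSymbol _ _).comp (contDiff_const_smul _)
  have hcs : HasCompactSupport (fun ξ : E3 => waveSymbol β (t * N) θ (N⁻¹ • ξ)) :=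
    (hβ.hasCompactSupport_waveSymbol _ _).comp_smul (inv_ne_zero hN.ne')
  set m : 𝓢(E3, ℂ) := hcs.toSchwartzMap hsm with hm
  have hmc : (m : E3 → ℂ) = fun ξ : E3 => waveSymbol β (t * N) θ (N⁻¹ • ξ) := rfl
  have hK : ∀ x, ‖𝓕⁻ (m : E3 → ℂ) x‖ ≤ D * (N ^ 3 / (1 + t * N)) := fun x => by
    rw [hmc, fourierInv_comp_smul (waveSymbol β (t * N) θ) hN, norm_mul, Complex.norm_real,
      Real.norm_of_nonneg (by positivity)]
    refine (mul_le_mul_of_nonneg_left (hD (t * N) θ (by positivity) (N • x))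
      (by positivity)).trans (le_of_eq (by ring))
  have hKm : Continuous (𝓕⁻ (m : E3 → ℂ)) := by
    rw [← SchwartzMap.fourierInv_coe]; exact (𝓕⁻ m : 𝓢(E3, ℂ)).continuous
  have hKi : ∀ x, ∀ f, BddInt f → Integrable (fun y => 𝓕⁻ (m : E3 → ℂ) (x - y) * f y) :=
    fun x f hf => hf.integrable.bdd_mul
      (hKm.comp (continuous_const.sub continuous_id)).aestronglyMeasurable
      (Filter.Eventually.of_forall fun y => hK (x - y))
  have key := lintegral_rpow_le_of_L1_L2 hp hq (A := A) (B := D * (N ^ 3 / (1 + t * N)))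
    (by positivity) (fun f x => ∫ y, 𝓕⁻ (m : E3 → ℂ) (x - y) * f y) ?_ ?_ ?_ ?_ H hH
  · simp_rw [integral_fourierInv_sub_mul m.integrable hH.integrable, hmc] at key
    refine key.trans (ENNReal.ofReal_le_ofReal (le_of_eq ?_))
    rw [← mul_assoc, Real.mul_rpow (by positivity) (by positivity)]
    ring
  · intro f hf
    refine (StronglyMeasurable.integral_prod_right (f := fun x y => 𝓕⁻ (m : E3 → ℂ) (x - y) * f y)
      ?_).measurable
    exact (((hKm.measurable.comp measurable_sub).mul
      (hf.measurable.comp measurable_snd))).stronglyMeasurable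
  · intro f g hf hg x
    simp only [Pi.add_apply, mul_add]
    rw [integral_add (hKi x f hf) (hKi x g hg)]
    exact norm_add_le _ _
  · intro f hf x
    rw [← integral_const_mul]
    refine norm_integral_le_of_norm_le (hf.integrable.norm.const_mul _)
      (Filter.Eventually.of_forall fun y => ?_)
    rw [norm_mul]
    exact mul_le_mul_of_nonneg_right (hK _) (norm_nonneg _)
  · intro f hf
    exact lintegral_multiplier_le m (fun ξ => hA _ _ _) hf

lemma eLpNorm_ofReal_eq {f : E3 → ℂ} {q : ℝ} (hq : 0 < q) :
    eLpNorm f (ENNReal.ofReal q) volume =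
      (∫⁻ x, ENNReal.ofReal (‖f x‖ ^ q)) ^ (1 / q) := by
  rw [eLpNorm_eq_lintegral_rpow_enorm_toReal (by simpa using hq) ENNReal.ofReal_ne_top,
    ENNReal.toReal_ofReal hq.le]
  congr 2; ext x
  rw [← ENNReal.ofReal_rpow_of_nonneg (norm_nonneg _) hq.le, ofReal_norm]

lemma BddInt.eLpNorm_eq {f : E3 → ℂ} (hf : BddInt f) {q : ℝ} (hq : 1 ≤ q) :
    eLpNorm f (ENNReal.ofReal q) volume = ENNReal.ofReal ((∫ x, ‖f x‖ ^ q) ^ (1 / q)) := by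
  have hq0 : 0 < q := by linarith
  rw [eLpNorm_ofReal_eq hq0, ← ofReal_integral_eq_lintegral_ofReal (hf.integrable_norm_rpow hq)
    (Filter.Eventually.of_forall fun _ => by positivity),
    ENNReal.ofReal_rpow_of_nonneg (integral_nonneg fun _ => by positivity) (by positivity)]

/-- The weighted dispersive estimate for a frequency-localised wave multiplier. -/
lemma AnnularBump.exists_weighted_le (hβ : AnnularBump β a b) {p : ℝ} (hp : 2 < p) :
    ∃ C : ℝ≥0, ∀ N t θ : ℝ, 0 < N → 0 ≤ t → ∀ H : E3 → ℂ, BddInt H →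
      ENNReal.ofReal (((1 + t * N) / N) ^ (1 - 2 / p)) *
        eLpNorm (𝓕⁻ (fun ξ => ((N ^ (-(2 - 4 / p)) : ℝ) : ℂ) *
          (waveSymbol β (t * N) θ (N⁻¹ • ξ) * 𝓕 H ξ))) (ENNReal.ofReal p) volume ≤
        C * eLpNorm H (ENNReal.ofReal (p / (p - 1))) volume := by
  have hp0 : 0 < p := by linarith
  have hp1 : 0 < p - 1 := by linarith
  have hp2 : 0 < p - 2 := by linarith
  have hq1 : 1 ≤ p / (p - 1) := by rw [le_div_iff₀ hp1]; linarith
  obtain ⟨C, hC0, hC⟩ := hβ.exists_lintegral_le hp rfl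
  refine ⟨Real.toNNReal (C ^ (1 / p)), fun N t θ hN ht H hH => ?_⟩
  have hfac : 𝓕⁻ (fun ξ => ((N ^ (-(2 - 4 / p)) : ℝ) : ℂ) *
      (waveSymbol β (t * N) θ (N⁻¹ • ξ) * 𝓕 H ξ)) = ((N ^ (-(2 - 4 / p)) : ℝ) : ℂ) •
      𝓕⁻ (fun ξ => waveSymbol β (t * N) θ (N⁻¹ • ξ) * 𝓕 H ξ) := by
    ext x
    simp_rw [Pi.smul_apply, Real.fourierInv_eq', smul_eq_mul, ← integral_const_mul]
    congr 1; ext ξ; ring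
  set Y := ∫ x, ‖H x‖ ^ (p / (p - 1)) with hY
  have hY0 : 0 ≤ Y := integral_nonneg fun _ => by positivity
  rw [hfac, eLpNorm_const_smul, hH.eLpNorm_eq hq1, eLpNorm_ofReal_eq hp0, ← hY]
  have hb := ENNReal.rpow_le_rpow (hC N t θ hN ht H hH) (z := 1 / p) (by positivity)
  rw [ENNReal.ofReal_rpow_of_nonneg (by positivity) (by positivity), ← hY] at hb
  have hN0 : 0 < N ^ (-(2 - 4 / p)) := by positivity
  rw [← ofReal_norm, Complex.norm_real, Real.norm_of_nonneg hN0.le]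
  refine (mul_le_mul_right (mul_le_mul_right hb _) _).trans (le_of_eq ?_)
  rw [← ENNReal.ofReal_mul hN0.le, ← ENNReal.ofReal_mul (by positivity), ENNReal.ofReal,
    ENNReal.ofReal, ← ENNReal.coe_mul, ← Real.toNNReal_mul (by positivity)]
  congr 2
  rw [Real.mul_rpow (by positivity) (by positivity), Real.mul_rpow (by positivity) (by positivity),
    ← Real.rpow_mul (by positivity), ← Real.rpow_mul (by positivity)]
  have e1 : (p - 2) * (1 / p) = 1 - 2 / p := by field_simp
  have e2 : (p - 1) * (1 / p) = 1 / (p / (p - 1)) := by field_simp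
  have e3 : -(2 - 4 / p) = -(2 * (1 - 2 / p)) := by ring
  rw [e1, e2, e3, Real.rpow_neg hN.le, Real.rpow_mul hN.le, Real.rpow_two]
  have hT : 0 < 1 + t * N := by positivity
  have e4 : ((1 + t * N) / N) ^ (1 - 2 / p) * (N ^ 3 / (1 + t * N)) ^ (1 - 2 / p) =
      (N ^ 2) ^ (1 - 2 / p) := by
    rw [← Real.mul_rpow (by positivity) (by positivity)]
    congr 1; field_simp
  have e5 : 0 < (N ^ 2) ^ (1 - 2 / p) := by positivity
  calc _ = (((1 + t * N) / N) ^ (1 - 2 / p) * (N ^ 3 / (1 + t * N)) ^ (1 - 2 / p)) *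
        ((N ^ 2) ^ (1 - 2 / p))⁻¹ * (C ^ (1 / p) * Y ^ (1 / (p / (p - 1)))) := by ring
    _ = _ := by rw [e4, mul_inv_cancel₀ e5.ne', one_mul]

end

lemma BddInt.add {f g : E3 → ℂ} (hf : BddInt f) (hg : BddInt g) : BddInt (f + g) where
  measurable := hf.measurable.add hg.measurable
  integrable := hf.integrable.add hg.integrable
  bounded := by
    obtain ⟨C, hC⟩ := hf.bounded
    obtain ⟨D, hD⟩ := hg.bounded
    exact ⟨C + D, fun x => (norm_add_le _ _).trans (add_le_add (hC x) (hD x))⟩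

lemma BddInt.sub {f g : E3 → ℂ} (hf : BddInt f) (hg : BddInt g) : BddInt (f - g) where
  measurable := hf.measurable.sub hg.measurable
  integrable := hf.integrable.sub hg.integrable
  bounded := by
    obtain ⟨C, hC⟩ := hf.bounded
    obtain ⟨D, hD⟩ := hg.bounded
    exact ⟨C + D, fun x => (norm_sub_le _ _).trans (add_le_add (hC x) (hD x))⟩

lemma BddInt.zero : BddInt 0 where
  measurable := measurable_zero
  integrable := integrable_zero _ _ _
  bounded := ⟨0, fun x => by simp⟩

lemma BddInt.sum {ι : Type*} (s : Finset ι) {f : ι → E3 → ℂ} (hf : ∀ i ∈ s, BddInt (f i)) :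
    BddInt (∑ i ∈ s, f i) := by
  classical
  induction s using Finset.induction_on with
  | empty => simpa using BddInt.zero
  | insert i s hi ih =>
    rw [Finset.sum_insert hi]
    exact (hf i (by simp)).add (ih fun j hj => hf j (by simp [hj]))

lemma BddInt.comp_add_right {f : E3 → ℂ} (hf : BddInt f) (z : E3) :
    BddInt (fun x => f (x + z)) where
  measurable := hf.measurable.comp (measurable_add_const z)
  integrable := hf.integrable.comp_add_right z
  bounded := by
    obtain ⟨C, hC⟩ := hf.bounded
    exact ⟨C, fun x => hC _⟩

lemma BddInt.norm {f : E3 → ℂ} (hf : BddInt f) : BddInt (fun x => ((‖f x‖ : ℝ) : ℂ)) where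
  measurable := Complex.measurable_ofReal.comp hf.measurable.norm
  integrable := hf.integrable.norm.ofReal
  bounded := by
    obtain ⟨C, hC⟩ := hf.bounded
    exact ⟨C, fun x => by simpa using hC x⟩

/-- A product of a bounded integrable function with a bounded measurable one. -/
lemma BddInt.mul_of_bdd {f g : E3 → ℂ} (hf : BddInt f) (hg : Measurable g) {C : ℝ}
    (hC : ∀ x, ‖g x‖ ≤ C) : BddInt (fun x => g x * f x) where
  measurable := hg.mul hf.measurable
  integrable := hf.integrable.bdd_mul hg.aestronglyMeasurable (Filter.Eventually.of_forall hC)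
  bounded := by
    obtain ⟨D, hD⟩ := hf.bounded
    refine ⟨C * D, fun x => ?_⟩
    rw [norm_mul]
    exact mul_le_mul (hC x) (hD x) (norm_nonneg _) ((norm_nonneg _).trans (hC x))

/-- The `L^p` norm as a real number. -/
def lpn (p : ℝ) (f : E3 → ℂ) : ℝ := (∫ x, ‖f x‖ ^ p) ^ (1 / p)

lemma lpn_nonneg (p : ℝ) (f : E3 → ℂ) : 0 ≤ lpn p f :=
  Real.rpow_nonneg (integral_nonneg fun _ => by positivity) _

lemma lpn_rpow {p : ℝ} (hp : 0 < p) (f : E3 → ℂ) : lpn p f ^ p = ∫ x, ‖f x‖ ^ p := by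
  rw [lpn, ← Real.rpow_mul (integral_nonneg fun _ => by positivity), one_div_mul_cancel hp.ne',
    Real.rpow_one]

lemma lpn_zero {p : ℝ} (hp : 0 < p) : lpn p 0 = 0 := by
  simp [lpn, Real.zero_rpow hp.ne', Real.zero_rpow (inv_ne_zero hp.ne')]

lemma BddInt.eLpNorm_eq_lpn {f : E3 → ℂ} (hf : BddInt f) {p : ℝ} (hp : 1 ≤ p) :
    eLpNorm f (ENNReal.ofReal p) volume = ENNReal.ofReal (lpn p f) := hf.eLpNorm_eq hp

lemma lpn_add_le {p : ℝ} (hp : 1 ≤ p) {f g : E3 → ℂ} (hf : BddInt f) (hg : BddInt g) :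
    lpn p (f + g) ≤ lpn p f + lpn p g := by
  have h := eLpNorm_add_le (p := ENNReal.ofReal p) (μ := volume) hf.integrable.1 hg.integrable.1
    (by simpa using hp)
  rw [hf.eLpNorm_eq_lpn hp, hg.eLpNorm_eq_lpn hp, (hf.add hg).eLpNorm_eq_lpn hp,
    ← ENNReal.ofReal_add (lpn_nonneg _ _) (lpn_nonneg _ _)] at h
  exact (ENNReal.ofReal_le_ofReal_iff (add_nonneg (lpn_nonneg _ _) (lpn_nonneg _ _))).1 h

lemma lpn_congr {p : ℝ} {f g : E3 → ℂ} (h : ∀ x, ‖f x‖ = ‖g x‖) : lpn p f = lpn p g := by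
  simp [lpn, h]

lemma lpn_comp_add_right (p : ℝ) (f : E3 → ℂ) (z : E3) :
    lpn p (fun x => f (x + z)) = lpn p f := by
  simp only [lpn]
  rw [integral_add_right_eq_self (fun x => ‖f x‖ ^ p) z]

lemma lpn_sub_le {p : ℝ} (hp : 1 ≤ p) {f g : E3 → ℂ} (hf : BddInt f) (hg : BddInt g) :
    lpn p (f - g) ≤ lpn p f + lpn p g := by
  have hg' : BddInt (-g) := by simpa using BddInt.zero.sub hg
  have := lpn_add_le hp hf hg'
  rwa [← sub_eq_add_neg, lpn_congr (f := -g) (g := g) (by simp)] at this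

lemma BddInt.lintegral_enorm_rpow {f : E3 → ℂ} (hf : BddInt f) {p : ℝ} (hp : 1 ≤ p) :
    ∫⁻ x, ‖f x‖ₑ ^ p = ENNReal.ofReal (lpn p f ^ p) := by
  have hp0 : 0 < p := by linarith
  rw [lpn_rpow hp0, ofReal_integral_eq_lintegral_ofReal (hf.integrable_norm_rpow hp)
    (Filter.Eventually.of_forall fun _ => by positivity)]
  congr 1; ext x
  rw [← ENNReal.ofReal_rpow_of_nonneg (norm_nonneg _) hp0.le, ofReal_norm]

lemma integral_rpow_mul_mul_le {p : ℝ} (hp : 2 < p) {f g h : E3 → ℂ} (hf : BddInt f)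
    (hg : BddInt g) (hh : BddInt h) :
    Integrable (fun x => ‖f x‖ ^ (p - 2) * ‖g x‖ * ‖h x‖) ∧
    ∫ x, ‖f x‖ ^ (p - 2) * ‖g x‖ * ‖h x‖ ≤ lpn p f ^ (p - 2) * lpn p g * lpn p h := by
  have hp2 : 0 < p - 2 := by linarith
  have hp0 : 0 < p := by linarith
  have hp1 : 1 ≤ p := by linarith
  have hm : AEStronglyMeasurable (fun x => ‖f x‖ ^ (p - 2) * ‖g x‖ * ‖h x‖) volume :=
    (((hf.measurable.norm.pow_const _).mul hg.measurable.norm).mul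
      hh.measurable.norm).aestronglyMeasurable
  have hnn : ∀ x, 0 ≤ ‖f x‖ ^ (p - 2) * ‖g x‖ * ‖h x‖ := fun x => by positivity
  have key := ENNReal.lintegral_prod_norm_pow_le (μ := volume) (Finset.univ : Finset (Fin 3))
    (f := ![fun x => ‖f x‖ₑ ^ p, fun x => ‖g x‖ₑ ^ p, fun x => ‖h x‖ₑ ^ p])
    (p := ![(p - 2) / p, 1 / p, 1 / p]) (by
      intro i _
      fin_cases i
      · exact (hf.measurable.enorm.pow_const p).aemeasurable
      · exact (hg.measurable.enorm.pow_const p).aemeasurable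
      · exact (hh.measurable.enorm.pow_const p).aemeasurable)
    (by simp [Fin.sum_univ_three]; field_simp; ring)
    (by
      intro i _
      fin_cases i
      · simp; positivity
      · simp; positivity
      · simp; positivity)
  simp only [Fin.prod_univ_three, Matrix.cons_val_zero, Matrix.cons_val_one, Matrix.cons_val,
    hf.lintegral_enorm_rpow hp1, hg.lintegral_enorm_rpow hp1, hh.lintegral_enorm_rpow hp1,
    ← ENNReal.rpow_mul] at key
  have e1 : p * ((p - 2) / p) = p - 2 := by field_simp
  have e2 : p * (1 / p) = 1 := by field_simp
  rw [e1, e2] at key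
  have hl := lpn_nonneg p
  rw [ENNReal.ofReal_rpow_of_nonneg (Real.rpow_nonneg (hl f) _) (by positivity),
    ENNReal.ofReal_rpow_of_nonneg (Real.rpow_nonneg (hl g) _) (by positivity),
    ENNReal.ofReal_rpow_of_nonneg (Real.rpow_nonneg (hl h) _) (by positivity),
    ← Real.rpow_mul (hl f), ← Real.rpow_mul (hl g), ← Real.rpow_mul (hl h), e1, e2,
    Real.rpow_one, Real.rpow_one, ← ENNReal.ofReal_mul (Real.rpow_nonneg (hl f) _),
    ← ENNReal.ofReal_mul (mul_nonneg (Real.rpow_nonneg (hl f) _) (hl g))] at key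
  have e3 : ∫⁻ x, ENNReal.ofReal (‖f x‖ ^ (p - 2) * ‖g x‖ * ‖h x‖) ≤
      ENNReal.ofReal (lpn p f ^ (p - 2) * lpn p g * lpn p h) := by
    refine le_trans (le_of_eq ?_) key
    congr 1; ext x
    rw [ENNReal.ofReal_mul (by positivity), ENNReal.ofReal_mul (by positivity),
      ← ENNReal.ofReal_rpow_of_nonneg (norm_nonneg _) hp2.le, ofReal_norm, ofReal_norm,
      ofReal_norm, ENNReal.rpow_one, ENNReal.rpow_one]
  refine ⟨⟨hm, ?_⟩, ?_⟩
  · rw [hasFiniteIntegral_iff_ofReal (Filter.Eventually.of_forall hnn)]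
    exact e3.trans_lt ENNReal.ofReal_lt_top
  · rw [integral_eq_lintegral_of_nonneg_ae (Filter.Eventually.of_forall hnn) hm]
    exact ENNReal.toReal_le_of_le_ofReal
      (mul_nonneg (mul_nonneg (Real.rpow_nonneg (hl f) _) (hl g)) (hl h)) e3

lemma rpow_add_one_sub_le {s x y : ℝ} (hs : 0 < s) (hx : 0 ≤ x) (hy : 0 ≤ y) :
    x ^ (s + 1) - y ^ (s + 1) ≤ (s + 1) * x ^ s * (x - y) := by
  rcases hx.eq_or_lt with rfl | hx
  · simp [Real.zero_rpow hs.ne', Real.zero_rpow (by linarith : s + 1 ≠ 0)]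
    positivity
  have h := one_add_mul_self_le_rpow_one_add (s := y / x - 1) (p := s + 1)
    (by have : 0 ≤ y / x := by positivity
        linarith) (by linarith)
  rw [add_sub_cancel, Real.div_rpow hy hx.le, le_div_iff₀ (by positivity)] at h
  have e : x ^ (s + 1) = x ^ s * x := Real.rpow_add_one hx.ne' s
  have : (1 + (s + 1) * (y / x - 1)) * x ^ (s + 1) =
      x ^ (s + 1) - (s + 1) * x ^ s * (x - y) := by
    rw [e]; field_simp; ring
  linarith

lemma abs_rpow_add_one_sub_le {s x y R : ℝ} (hs : 0 < s) (hx : 0 ≤ x) (hy : 0 ≤ y)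
    (hxR : x ≤ R) (hyR : y ≤ R) :
    |x ^ (s + 1) - y ^ (s + 1)| ≤ (s + 1) * R ^ s * |x - y| := by
  wlog h : y ≤ x generalizing x y
  · rw [abs_sub_comm, abs_sub_comm x]
    exact this hy hx hyR hxR (by linarith)
  rw [abs_of_nonneg (sub_nonneg.2 (Real.rpow_le_rpow hy h (by linarith))),
    abs_of_nonneg (sub_nonneg.2 h)]
  refine (rpow_add_one_sub_le hs hx hy).trans ?_
  have := sub_nonneg.2 h
  gcongr

/-- The duality map `a ↦ |a|^{p-2} a` is locally Lipschitz. -/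
lemma norm_rpow_smul_sub_le {p R : ℝ} (hp : 2 < p) {a b : ℂ} (ha : ‖a‖ ≤ R) (hb : ‖b‖ ≤ R) :
    ‖‖a‖ ^ (p - 2) • a - ‖b‖ ^ (p - 2) • b‖ ≤ p * R ^ (p - 2) * ‖a - b‖ := by
  have hs : 0 < p - 2 := by linarith
  have hR : 0 ≤ R := (norm_nonneg a).trans ha
  have key : |‖a‖ ^ (p - 2) - ‖b‖ ^ (p - 2)| * ‖b‖ ≤ (p - 2 + 1) * R ^ (p - 2) * ‖a - b‖ := by
    have h1 := abs_rpow_add_one_sub_le hs (norm_nonneg a) (norm_nonneg b) ha hb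
    rw [Real.rpow_add_one' (norm_nonneg _) (by linarith),
      Real.rpow_add_one' (norm_nonneg _) (by linarith)] at h1
    have h2 : |‖a‖ - ‖b‖| ≤ ‖a - b‖ := abs_norm_sub_norm_le a b
    have h3 : |‖a‖ ^ (p - 2) - ‖b‖ ^ (p - 2)| * ‖b‖ ≤
        |‖a‖ ^ (p - 2) * ‖a‖ - ‖b‖ ^ (p - 2) * ‖b‖| := by
      rcases le_total ‖a‖ ‖b‖ with h | h
      · have h4 := Real.rpow_le_rpow (norm_nonneg a) h hs.le
        rw [abs_of_nonpos (by linarith)]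
        refine le_trans ?_ (neg_le_abs _)
        nlinarith [Real.rpow_nonneg (norm_nonneg a) (p - 2)]
      · have h4 := Real.rpow_le_rpow (norm_nonneg b) h hs.le
        rw [abs_of_nonneg (by linarith)]
        refine le_trans ?_ (le_abs_self _)
        nlinarith [Real.rpow_nonneg (norm_nonneg a) (p - 2)]
    refine h3.trans (h1.trans ?_)
    gcongr
  have e : ‖a‖ ^ (p - 2) • a - ‖b‖ ^ (p - 2) • b =
      ‖a‖ ^ (p - 2) • (a - b) + (‖a‖ ^ (p - 2) - ‖b‖ ^ (p - 2)) • b := by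
    rw [smul_sub, sub_smul]; abel
  rw [e]
  refine (norm_add_le _ _).trans ?_
  rw [norm_smul, norm_smul, Real.norm_of_nonneg (by positivity), Real.norm_eq_abs]
  have : ‖a‖ ^ (p - 2) * ‖a - b‖ ≤ R ^ (p - 2) * ‖a - b‖ := by gcongr
  linarith

lemma norm_add_rpow_le {p : ℝ} (hp : 2 < p) (a b : ℂ) :
    ‖a + b‖ ^ p ≤ ‖a‖ ^ p + p * ⟪‖a‖ ^ (p - 2) • a, b⟫
      + p ^ 2 * ((‖a‖ + ‖b‖) ^ (p - 2) * ‖b‖ ^ 2) := by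
  have hd : ∀ t : ℝ, HasDerivAt (fun t : ℝ => ‖a + t • b‖ ^ p)
      (p * ⟪‖a + t • b‖ ^ (p - 2) • (a + t • b), b⟫) t := by
    intro t
    have h1 : HasDerivAt (fun t : ℝ => a + t • b) b t := by
      simpa using ((hasDerivAt_id t).smul_const b).const_add a
    have h2 := (hasFDerivAt_norm_rpow (a + t • b) (by linarith : 1 < p)).comp_hasDerivAt t h1
    refine h2.congr_deriv ?_
    simp
    ring
  obtain ⟨c, hc, h⟩ := exists_hasDerivAt_eq_slope (fun t : ℝ => ‖a + t • b‖ ^ p) _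
    (zero_lt_one' ℝ) (fun t _ => (hd t).continuousAt.continuousWithinAt) (fun t _ => hd t)
  simp only [one_smul, zero_smul, add_zero, sub_zero, div_one] at h
  have hcb : ‖c • b‖ ≤ ‖b‖ := by
    rw [norm_smul, Real.norm_of_nonneg hc.1.le]
    exact mul_le_of_le_one_left (norm_nonneg _) hc.2.le
  have hJ := norm_rpow_smul_sub_le hp (a := a + c • b) (b := a) (R := ‖a‖ + ‖b‖)
    ((norm_add_le _ _).trans (by linarith)) (by linarith [norm_nonneg b])
  rw [add_sub_cancel_left] at hJ
  have hin : ⟪‖a + c • b‖ ^ (p - 2) • (a + c • b), b⟫ ≤ ⟪‖a‖ ^ (p - 2) • a, b⟫ +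
      p * ((‖a‖ + ‖b‖) ^ (p - 2) * ‖b‖ ^ 2) := by
    rw [← sub_le_iff_le_add', ← inner_sub_left]
    refine (real_inner_le_norm _ _).trans ?_
    calc _ ≤ p * (‖a‖ + ‖b‖) ^ (p - 2) * ‖b‖ * ‖b‖ := by
          gcongr
          exact hJ.trans (by gcongr)
      _ = _ := by ring
  have := mul_le_mul_of_nonneg_left hin (by linarith : 0 ≤ p)
  linarith

/-- The correlation of a kernel `κ` with a function `d`. -/
def corr (κ d : E3 → ℂ) (y : E3) : ℂ := ∫ z, κ z * d (y + z)

lemma integrable_corr_integrand {κ d : E3 → ℂ} (hκ : BddInt κ) (hd : BddInt d) :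
    Integrable (fun w : E3 × E3 => κ w.2 * d (w.1 + w.2)) (volume.prod volume) := by
  have h := (measurePreserving_prod_add (volume : Measure E3) (volume : Measure E3)).integrable_comp
    (hκ.integrable.mul_prod hd.integrable).1 |>.2 (hκ.integrable.mul_prod hd.integrable)
  refine h.swap.congr (Filter.Eventually.of_forall fun w => ?_)
  simp [add_comm]

lemma BddInt.corr {κ d : E3 → ℂ} (hκ : BddInt κ) (hd : BddInt d) : BddInt (corr κ d) where
  measurable := by
    have : Measurable fun w : E3 × E3 => κ w.2 * d (w.1 + w.2) :=
      (hκ.measurable.comp measurable_snd).mul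
        (hd.measurable.comp (measurable_fst.add measurable_snd))
    exact this.stronglyMeasurable.integral_prod_right.measurable
  integrable := (integrable_corr_integrand hκ hd).integral_prod_left
  bounded := by
    obtain ⟨C, hC⟩ := hd.bounded
    refine ⟨∫ z, ‖κ z‖ * C, fun y => ?_⟩
    refine norm_integral_le_of_norm_le (hκ.integrable.norm.mul_const C)
      (Filter.Eventually.of_forall fun z => ?_)
    rw [norm_mul]
    exact mul_le_mul_of_nonneg_left (hC _) (norm_nonneg _)

lemma integral_mul_corr {κ d w : E3 → ℂ} (hκ : BddInt κ) (hd : BddInt d) (hw : Measurable w)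
    {C : ℝ} (hC : ∀ x, ‖w x‖ ≤ C) :
    Integrable (fun z => κ z * ∫ y, w y * d (y + z)) ∧
    ∫ y, w y * corr κ d y = ∫ z, κ z * ∫ y, w y * d (y + z) := by
  have hi : Integrable (fun v : E3 × E3 => w v.1 * (κ v.2 * d (v.1 + v.2)))
      (volume.prod volume) :=
    (integrable_corr_integrand hκ hd).bdd_mul (hw.comp measurable_fst).aestronglyMeasurable
      (Filter.Eventually.of_forall fun v => hC v.1)
  have e : ∀ z, κ z * ∫ y, w y * d (y + z) = ∫ y, w y * (κ z * d (y + z)) := fun z => by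
    rw [← integral_const_mul]
    exact integral_congr_ae (Filter.Eventually.of_forall fun y => by ring)
  constructor
  · simp_rw [e]
    exact hi.integral_prod_right
  · simp_rw [e, corr, ← integral_const_mul]
    exact integral_integral_swap hi

/-- Moving a correlation onto the other factor turns it into a convolution. -/
lemma integral_mul_corr_eq {κ d w : E3 → ℂ} (hκ : BddInt κ) (hd : BddInt d) (hw : Measurable w)
    {C : ℝ} (hC : ∀ x, ‖w x‖ ≤ C) :
    ∫ y, w y * corr κ d y = ∫ x, d x * ∫ z, w (x - z) * κ z := by
  rw [(integral_mul_corr hκ hd hw hC).2]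
  have hi : Integrable (fun v : E3 × E3 => w (v.1 - v.2) * (d v.1 * κ v.2))
      (volume.prod volume) :=
    (hd.integrable.mul_prod hκ.integrable).bdd_mul
      (hw.comp (measurable_fst.sub measurable_snd)).aestronglyMeasurable
      (Filter.Eventually.of_forall fun v => hC _)
  have e : ∀ z, κ z * ∫ y, w y * d (y + z) = ∫ x, w (x - z) * (d x * κ z) := fun z => by
    rw [← integral_add_right_eq_self (fun x => w (x - z) * (d x * κ z)) z, ← integral_const_mul]
    refine integral_congr_ae (Filter.Eventually.of_forall fun y => ?_)
    simp only [add_sub_cancel_right]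
    ring
  simp_rw [e]
  rw [← integral_integral_swap hi]
  refine integral_congr_ae (Filter.Eventually.of_forall fun x => ?_)
  simp only [← integral_const_mul]
  exact integral_congr_ae (Filter.Eventually.of_forall fun z => by ring)

/-- The dual function `|f|^{p-2} conj f`. -/
def dualFun (p : ℝ) (f : E3 → ℂ) (x : E3) : ℂ := ((‖f x‖ ^ (p - 2) : ℝ) : ℂ) * (starRingEnd ℂ) (f x)

lemma BddInt.dualFun {p : ℝ} (hp : 2 < p) {f : E3 → ℂ} (hf : BddInt f) : BddInt (dualFun p f) := by
  obtain ⟨C, hC⟩ := hf.bounded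
  have h : BddInt (fun x => (starRingEnd ℂ) (f x)) :=
    { measurable := Complex.continuous_conj.measurable.comp hf.measurable
      integrable := hf.integrable.congr' (Complex.continuous_conj.measurable.comp
        hf.measurable).aestronglyMeasurable (Filter.Eventually.of_forall fun x => by simp)
      bounded := ⟨C, fun x => by simpa using hC x⟩ }
  refine h.mul_of_bdd (C := C ^ (p - 2))
    (Complex.measurable_ofReal.comp (hf.measurable.norm.pow_const _)) fun x => ?_
  rw [Complex.norm_real, Real.norm_of_nonneg (by positivity)]
  exact Real.rpow_le_rpow (norm_nonneg _) (hC x) (by linarith)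

lemma norm_dualFun {p : ℝ} (f : E3 → ℂ) (x : E3) : ‖dualFun p f x‖ = ‖f x‖ ^ (p - 2) * ‖f x‖ := by
  rw [dualFun, norm_mul, Complex.norm_real, Real.norm_of_nonneg (by positivity),
    RCLike.norm_conj]

lemma norm_dualFun_sub_le {p : ℝ} (hp : 2 < p) (f : E3 → ℂ) (x y : E3) :
    ‖dualFun p f x - dualFun p f y‖ ≤ p * (‖f x‖ + ‖f y‖) ^ (p - 2) * ‖f x - f y‖ := by
  have h := norm_rpow_smul_sub_le hp (a := f x) (b := f y) (R := ‖f x‖ + ‖f y‖)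
    (by linarith [norm_nonneg (f y)]) (by linarith [norm_nonneg (f x)])
  refine le_trans (le_of_eq ?_) h
  rw [← RCLike.norm_conj]
  simp [dualFun]

lemma dualFun_mul_self {p : ℝ} (hp : 0 < p) (f : E3 → ℂ) (x : E3) :
    dualFun p f x * f x = ((‖f x‖ ^ p : ℝ) : ℂ) := by
  rw [dualFun, mul_assoc, mul_comm ((starRingEnd ℂ) (f x)), Complex.mul_conj,
    Complex.normSq_eq_norm_sq, ← Complex.ofReal_mul]
  congr 1
  rw [← Real.rpow_natCast, ← Real.rpow_add' (norm_nonneg _) (by norm_num; exact hp.ne')]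
  norm_num

lemma inner_eq_re_dualFun_mul (p : ℝ) (f : E3 → ℂ) (x : E3) (b : ℂ) :
    ⟪‖f x‖ ^ (p - 2) • f x, b⟫ = (dualFun p f x * b).re := by
  rw [Complex.inner, dualFun]
  simp [mul_comm]

/-- Young's inequality. -/
lemma lpn_corr_le {p : ℝ} (hp : 2 < p) {κ d : E3 → ℂ} (hκ : BddInt κ) (hd : BddInt d) :
    lpn p (corr κ d) ≤ (∫ z, ‖κ z‖) * lpn p d := by
  have hp0 : 0 < p := by linarith
  set G := corr κ d with hG
  have hGb : BddInt G := hκ.corr hd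
  have hw := hGb.dualFun hp
  obtain ⟨C, hC⟩ := hw.bounded
  have hL := lpn_nonneg p G
  have hK : 0 ≤ ∫ z, ‖κ z‖ := integral_nonneg fun _ => norm_nonneg _
  have h1 : ((lpn p G ^ p : ℝ) : ℂ) = ∫ z, κ z * ∫ y, dualFun p G y * d (y + z) := by
    rw [← (integral_mul_corr hκ hd hw.measurable hC).2, lpn_rpow hp0, ← integral_complex_ofReal]
    exact integral_congr_ae (Filter.Eventually.of_forall fun y => (dualFun_mul_self hp0 G y).symm)
  have h2 : lpn p G ^ p ≤ ∫ z, ‖κ z‖ * (lpn p G ^ (p - 2) * lpn p G * lpn p d) := by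
    rw [← Real.norm_of_nonneg (Real.rpow_nonneg hL p), ← Complex.norm_real, h1]
    refine norm_integral_le_of_norm_le (hκ.integrable.norm.mul_const _)
      (Filter.Eventually.of_forall fun z => ?_)
    rw [norm_mul]
    refine mul_le_mul_of_nonneg_left ?_ (norm_nonneg _)
    have h3 := integral_rpow_mul_mul_le hp hGb hGb (hd.comp_add_right z)
    rw [lpn_comp_add_right] at h3
    refine (norm_integral_le_of_norm_le h3.1 (Filter.Eventually.of_forall fun y => ?_)).trans h3.2
    rw [norm_mul, norm_dualFun]
  rw [integral_mul_const] at h2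
  rcases hL.eq_or_lt with h0 | h0
  · rw [← h0]
    exact mul_nonneg hK (lpn_nonneg _ _)
  · have e : lpn p G ^ p = lpn p G ^ (p - 2) * lpn p G * lpn p G := by
      rw [← Real.rpow_add_one h0.ne', ← Real.rpow_add_one h0.ne']
      ring_nf
    rw [e] at h2
    have : 0 < lpn p G ^ (p - 2) * lpn p G := by positivity
    refine le_of_mul_le_mul_left ?_ this
    linarith

lemma lpn_corr_sub_le {p : ℝ} (hp : 2 < p) {κ d : E3 → ℂ} (hκ : BddInt κ) (hd : BddInt d)
    (h : E3) : lpn p (fun y => corr κ d (y + h) - corr κ d y) ≤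
      (∫ z, ‖κ (z + -h) - κ z‖) * lpn p d := by
  have hκ' : BddInt (fun z => κ (z + -h) - κ z) := (hκ.comp_add_right (-h)).sub hκ
  refine le_trans (le_of_eq ?_) (lpn_corr_le hp hκ' hd)
  congr 1; ext y
  obtain ⟨C, hC⟩ := hd.bounded
  have hi : ∀ {κ' : E3 → ℂ}, BddInt κ' → Integrable (fun z => κ' z * d (y + z)) := fun hk =>
    hk.integrable.mul_bdd (hd.measurable.comp (measurable_const_add y)).aestronglyMeasurable
      (Filter.Eventually.of_forall fun z => hC _)
  simp only [corr, sub_mul]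
  rw [integral_sub (hi (hκ.comp_add_right (-h))) (hi hκ)]
  congr 1
  rw [← integral_add_right_eq_self (fun z => κ (z + -h) * d (y + z)) h]
  refine integral_congr_ae (Filter.Eventually.of_forall fun z => ?_)
  simp only [add_neg_cancel_right]
  rw [add_assoc, add_comm h z]

/-- The cross term: smoothness of `S` against cancellation of `κ`. -/
lemma re_integral_dualFun_mul_corr_le {p A M : ℝ} (hp : 2 < p) {κ d S : E3 → ℂ} (hκ : BddInt κ)
    (hκ0 : ∫ z, κ z = 0) (hκm : Integrable fun z => ‖κ z‖ * ‖z‖)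
    (hA : ∫ z, ‖κ z‖ * ‖z‖ ≤ A) (hd : BddInt d) (hS : BddInt S) (hM : 0 ≤ M)
    (hSM : ∀ h, lpn p (fun y => S (y + h) - S y) ≤ M * ‖h‖) :
    (∫ y, dualFun p S y * corr κ d y).re ≤
      p * ((2 * lpn p S) ^ (p - 2) * M * lpn p d * A) := by
  have hp0 : 0 < p := by linarith
  have hp2 : 0 < p - 2 := by linarith
  have hw := hS.dualFun hp
  obtain ⟨C, hC⟩ := hw.bounded
  obtain ⟨D, hD⟩ := hd.bounded
  obtain ⟨hint, heq⟩ := integral_mul_corr hκ hd hw.measurable hC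
  have hLS := lpn_nonneg p S
  have hLd := lpn_nonneg p d
  have hi : ∀ {w : E3 → ℂ}, BddInt w → Integrable (fun y => w y * d y) := fun hw' =>
    hw'.integrable.mul_bdd hd.measurable.aestronglyMeasurable
      (Filter.Eventually.of_forall fun z => hD _)
  set c := ∫ y, dualFun p S y * d y with hc
  set B := p * ((2 * lpn p S) ^ (p - 2) * M * lpn p d) with hB
  have hB0 : 0 ≤ B := by positivity
  have hΨ : ∀ z, ‖(∫ y, dualFun p S y * d (y + z)) - c‖ ≤ B * ‖z‖ := by
    intro z
    have e : ∫ y, dualFun p S y * d (y + z) = ∫ y, dualFun p S (y + -z) * d y := by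
      rw [← integral_add_right_eq_self (fun y => dualFun p S (y + -z) * d y) z]
      simp
    rw [e, hc, ← integral_sub (hi (hw.comp_add_right (-z))) (hi hw)]
    have hS' := hS.comp_add_right (-z)
    have h3 := integral_rpow_mul_mul_le hp (hS'.norm.add hS.norm) (hS'.sub hS) hd
    have h4 : lpn p ((fun x => ((‖S (x + -z)‖ : ℝ) : ℂ)) + fun x => ((‖S x‖ : ℝ) : ℂ)) ≤
        2 * lpn p S := by
      refine (lpn_add_le (by linarith) hS'.norm hS.norm).trans (le_of_eq ?_)
      rw [two_mul, lpn_congr (g := fun x => S (x + -z)) (by simp), lpn_comp_add_right,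
        lpn_congr (f := fun x => ((‖S x‖ : ℝ) : ℂ)) (g := S) (by simp)]
    have h5 : lpn p ((fun x => S (x + -z)) - S) ≤ M * ‖z‖ := by
      have := hSM (-z)
      rwa [norm_neg] at this
    refine (norm_integral_le_of_norm_le (h3.1.const_mul p)
      (Filter.Eventually.of_forall fun y => ?_)).trans ?_
    · rw [← sub_mul, norm_mul]
      have h6 := norm_dualFun_sub_le hp S (y + -z) y
      have h7 : ‖((fun x => ((‖S (x + -z)‖ : ℝ) : ℂ)) + fun x => ((‖S x‖ : ℝ) : ℂ)) y‖ =
          ‖S (y + -z)‖ + ‖S y‖ := by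
        rw [Pi.add_apply, ← Complex.ofReal_add, Complex.norm_real,
          Real.norm_of_nonneg (by positivity)]
      rw [h7, Pi.sub_apply]
      refine (mul_le_mul_of_nonneg_right h6 (norm_nonneg _)).trans (le_of_eq (by ring))
    · rw [integral_const_mul, hB]
      have h8 := h3.2.trans (mul_le_mul_of_nonneg_right (mul_le_mul (Real.rpow_le_rpow
        (lpn_nonneg _ _) h4 hp2.le) h5 (lpn_nonneg _ _) (by positivity)) hLd)
      refine (mul_le_mul_of_nonneg_left h8 hp0.le).trans (le_of_eq (by ring))
  have e2 : ∫ z, κ z * ∫ y, dualFun p S y * d (y + z) =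
      ∫ z, κ z * ((∫ y, dualFun p S y * d (y + z)) - c) := by
    simp_rw [mul_sub]
    rw [integral_sub hint (hκ.integrable.mul_const c), integral_mul_const, hκ0, zero_mul, sub_zero]
  rw [heq, e2]
  refine (Complex.re_le_norm _).trans ?_
  refine (norm_integral_le_of_norm_le (hκm.const_mul B)
    (Filter.Eventually.of_forall fun z => ?_)).trans ?_
  · rw [norm_mul]
    refine (mul_le_mul_of_nonneg_left (hΨ z) (norm_nonneg _)).trans (le_of_eq (by ring))
  · rw [integral_const_mul]
    refine (mul_le_mul_of_nonneg_left hA hB0).trans (le_of_eq ?_)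
    rw [hB]; ring

/-- Quantitative control of an `L¹`-normalised kernel at frequency `l`. -/
structure GoodKernel (κ : E3 → ℂ) (A l : ℝ) : Prop where
  bddInt : BddInt κ
  norm_le : ∫ z, ‖κ z‖ ≤ A
  integral_eq_zero : ∫ z, κ z = 0
  integrable_moment : Integrable fun z => ‖κ z‖ * ‖z‖
  moment_le : ∫ z, ‖κ z‖ * ‖z‖ ≤ A / l
  translate_le : ∀ h, ∫ z, ‖κ (z + h) - κ z‖ ≤ A * l * ‖h‖

/-- Geometric averages of the preceding terms of a sequence. -/
def geomAvg (D : ℕ → ℝ) : ℕ → ℝ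
  | 0 => 0
  | k + 1 => (geomAvg D k + D k) / 2

lemma geomAvg_nonneg {D : ℕ → ℝ} (hD : ∀ k, 0 ≤ D k) (k : ℕ) : 0 ≤ geomAvg D k := by
  induction k with
  | zero => exact le_rfl
  | succ k ih =>
    have := hD k
    simp only [geomAvg]
    positivity

lemma sum_mul_geomAvg_le (D : ℕ → ℝ) (n : ℕ) :
    ∑ k ∈ Finset.range n, D k * geomAvg D k + geomAvg D n ^ 2 ≤ ∑ k ∈ Finset.range n, D k ^ 2 := by
  induction n with
  | zero => simp [geomAvg]
  | succ n ih =>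
    rw [Finset.sum_range_succ, Finset.sum_range_succ]
    simp only [geomAvg]
    nlinarith [sq_nonneg (D n - geomAvg D n)]

lemma lpn_sum_corr_sub_le {p A l : ℝ} (hp : 2 < p) {κ d : ℕ → E3 → ℂ}
    (hκ : ∀ k, GoodKernel (κ k) A (l * 2 ^ k)) (hd : ∀ k, BddInt (d k)) (k : ℕ) (h : E3) :
    lpn p (fun y => (∑ j ∈ Finset.range k, corr (κ j) (d j)) (y + h)
      - (∑ j ∈ Finset.range k, corr (κ j) (d j)) y) ≤
      A * (l * 2 ^ k) * geomAvg (fun j => lpn p (d j)) k * ‖h‖ := by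
  have hc : ∀ j, BddInt (corr (κ j) (d j)) := fun j => (hκ j).bddInt.corr (hd j)
  induction k with
  | zero =>
    simp only [Finset.range_zero, Finset.sum_empty, Pi.zero_apply, sub_zero, geomAvg]
    have := lpn_zero (show 0 < p by linarith)
    simp only [Pi.zero_def] at this
    simp [this]
  | succ k ih =>
    have hS : BddInt (∑ j ∈ Finset.range k, corr (κ j) (d j)) := BddInt.sum _ fun j _ => hc j
    have e : (fun y => (∑ j ∈ Finset.range (k + 1), corr (κ j) (d j)) (y + h)
        - (∑ j ∈ Finset.range (k + 1), corr (κ j) (d j)) y) =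
        (fun y => (∑ j ∈ Finset.range k, corr (κ j) (d j)) (y + h)
          - (∑ j ∈ Finset.range k, corr (κ j) (d j)) y) +
        (fun y => corr (κ k) (d k) (y + h) - corr (κ k) (d k) y) := by
      ext y
      simp only [Finset.sum_range_succ, Pi.add_apply]
      ring
    rw [e]
    have h1 := lpn_add_le (p := p) (by linarith) ((hS.comp_add_right h).sub hS)
      (((hc k).comp_add_right h).sub (hc k))
    have h2 := lpn_corr_sub_le hp (hκ k).bddInt (hd k) h
    have h3 := (hκ k).translate_le (-h)
    rw [norm_neg] at h3
    have h4 := h2.trans (mul_le_mul_of_nonneg_right h3 (lpn_nonneg p (d k)))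
    refine h1.trans ((add_le_add ih h4).trans (le_of_eq ?_))
    simp only [geomAvg]
    ring

lemma lpn_add_corr_rpow_le {p A M X l : ℝ} (hp : 2 < p) {κ d S : E3 → ℂ} (hκ : GoodKernel κ A l)
    (hd : BddInt d) (hS : BddInt S) (hM : 0 ≤ M) (hA : 0 ≤ A) (hl : 0 < l)
    (hSM : ∀ h, lpn p (fun y => S (y + h) - S y) ≤ A * l * M * ‖h‖)
    (hX : lpn p S ≤ X) (hX' : lpn p (S + corr κ d) ≤ X) :
    lpn p (S + corr κ d) ^ p ≤ lpn p S ^ p +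
      p ^ 2 * (3 * X) ^ (p - 2) * A ^ 2 * (lpn p d * M + lpn p d ^ 2) := by
  have hp0 : 0 < p := by linarith
  have hp1 : 1 ≤ p := by linarith
  have hp2 : 0 < p - 2 := by linarith
  set F := corr κ d with hF
  have hFb : BddInt F := hκ.bddInt.corr hd
  have hLS := lpn_nonneg p S
  have hLd := lpn_nonneg p d
  have hX0 : 0 ≤ X := hLS.trans hX
  have hF1 : lpn p F ≤ A * lpn p d := (lpn_corr_le hp hκ.bddInt hd).trans
    (mul_le_mul_of_nonneg_right hκ.norm_le hLd)
  have hF2 : lpn p F ≤ 2 * X := by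
    have := lpn_sub_le hp1 (hS.add hFb) hS
    rw [add_sub_cancel_left] at this
    linarith
  have hN : lpn p ((fun x => ((‖S x‖ : ℝ) : ℂ)) + fun x => ((‖F x‖ : ℝ) : ℂ)) ≤ 3 * X := by
    refine (lpn_add_le hp1 hS.norm hFb.norm).trans ?_
    rw [lpn_congr (f := fun x => ((‖S x‖ : ℝ) : ℂ)) (g := S) (by simp),
      lpn_congr (f := fun x => ((‖F x‖ : ℝ) : ℂ)) (g := F) (by simp)]
    linarith
  have h3 := integral_rpow_mul_mul_le hp (hS.norm.add hFb.norm) hFb hFb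
  have h4 : ∫ x, ‖((fun x => ((‖S x‖ : ℝ) : ℂ)) + fun x => ((‖F x‖ : ℝ) : ℂ)) x‖ ^ (p - 2) *
      ‖F x‖ * ‖F x‖ ≤ (3 * X) ^ (p - 2) * (A * lpn p d) * (A * lpn p d) := by
    refine h3.2.trans ?_
    have := lpn_nonneg p F
    have h5 := Real.rpow_le_rpow (lpn_nonneg _ _) hN hp2.le
    gcongr
  have hcross := re_integral_dualFun_mul_corr_le hp hκ.bddInt hκ.integral_eq_zero
    hκ.integrable_moment hκ.moment_le hd hS (M := A * l * M) (by positivity) hSM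
  have hcross' : (∫ y, dualFun p S y * F y).re ≤
      p * ((3 * X) ^ (p - 2) * A ^ 2 * (lpn p d * M)) := by
    refine hcross.trans ?_
    have : (2 * lpn p S) ^ (p - 2) ≤ (3 * X) ^ (p - 2) :=
      Real.rpow_le_rpow (by positivity) (by linarith) hp2.le
    calc _ = p * ((2 * lpn p S) ^ (p - 2) * (A ^ 2 * (lpn p d * M))) := by
          field_simp
      _ ≤ p * ((3 * X) ^ (p - 2) * (A ^ 2 * (lpn p d * M))) := by gcongr
      _ = _ := by ring
  have hi1 : Integrable fun y => dualFun p S y * F y := by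
    obtain ⟨C, hC⟩ := hFb.bounded
    exact (hS.dualFun hp).integrable.mul_bdd hFb.measurable.aestronglyMeasurable
      (Filter.Eventually.of_forall hC)
  have hre : Integrable fun y => (dualFun p S y * F y).re := hi1.re
  have hmain : ∫ x, ‖(S + F) x‖ ^ p ≤ ∫ x, (‖S x‖ ^ p + p * (dualFun p S x * F x).re + p ^ 2 *
      (‖((fun x => ((‖S x‖ : ℝ) : ℂ)) + fun x => ((‖F x‖ : ℝ) : ℂ)) x‖ ^ (p - 2) *
      ‖F x‖ * ‖F x‖)) := by
    refine integral_mono ((hS.add hFb).integrable_norm_rpow hp1)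
      (((hS.integrable_norm_rpow hp1).add (hre.const_mul p)).add (h3.1.const_mul _)) fun x => ?_
    have h7 : ‖((fun x => ((‖S x‖ : ℝ) : ℂ)) + fun x => ((‖F x‖ : ℝ) : ℂ)) x‖ =
        ‖S x‖ + ‖F x‖ := by
      rw [Pi.add_apply, ← Complex.ofReal_add, Complex.norm_real,
        Real.norm_of_nonneg (by positivity)]
    simp only [h7, ← inner_eq_re_dualFun_mul]
    refine (norm_add_rpow_le hp (S x) (F x)).trans (le_of_eq (by ring))
  have hi2 : Integrable fun x => ‖S x‖ ^ p + p * (dualFun p S x * F x).re :=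
    (hS.integrable_norm_rpow hp1).add (hre.const_mul p)
  rw [integral_add hi2 (h3.1.const_mul _), integral_add (hS.integrable_norm_rpow hp1) (hre.const_mul p), integral_const_mul,
    integral_const_mul, ← lpn_rpow hp0, ← lpn_rpow hp0] at hmain
  have hre2 : ∫ y, (dualFun p S y * F y).re = (∫ y, dualFun p S y * F y).re := by
    exact integral_re hi1
  rw [hre2] at hmain
  have h8 := mul_le_mul_of_nonneg_left hcross' hp0.le
  have h9 := mul_le_mul_of_nonneg_left h4 (sq_nonneg p)
  refine hmain.trans ?_
  calc _ ≤ lpn p S ^ p + p * (p * ((3 * X) ^ (p - 2) * A ^ 2 * (lpn p d * M))) +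
        p ^ 2 * ((3 * X) ^ (p - 2) * (A * lpn p d) * (A * lpn p d)) := by gcongr
    _ = _ := by ring

/-- A type 2 inequality for sums of frequency-localised functions. -/
theorem lpn_sum_corr_sq_le {p A l : ℝ} (hp : 2 < p) (hA : 0 ≤ A) (hl : 0 < l)
    {κ d : ℕ → E3 → ℂ} (hκ : ∀ k, GoodKernel (κ k) A (l * 2 ^ k)) (hd : ∀ k, BddInt (d k))
    (n : ℕ) :
    lpn p (∑ k ∈ Finset.range n, corr (κ k) (d k)) ^ 2 ≤
      2 * p ^ 2 * 3 ^ (p - 2) * A ^ 2 * ∑ k ∈ Finset.range n, lpn p (d k) ^ 2 := by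
  have hp0 : 0 < p := by linarith
  have hp2 : 0 < p - 2 := by linarith
  set S : ℕ → E3 → ℂ := fun m => ∑ k ∈ Finset.range m, corr (κ k) (d k) with hS
  set D : ℕ → ℝ := fun k => lpn p (d k) with hD
  have hD0 : ∀ k, 0 ≤ D k := fun k => lpn_nonneg _ _
  have hSb : ∀ m, BddInt (S m) := fun m => BddInt.sum _ fun j _ => (hκ j).bddInt.corr (hd j)
  obtain ⟨m, hm, hmax⟩ := Finset.exists_max_image (Finset.range (n + 1)) (fun m => lpn p (S m))
    ⟨0, by simp⟩
  set X := lpn p (S m) with hX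
  have hX0 : 0 ≤ X := lpn_nonneg _ _
  set B := p ^ 2 * (3 * X) ^ (p - 2) * A ^ 2 with hB
  have hB0 : 0 ≤ B := by positivity
  have hstep : ∀ k, k ≤ n → lpn p (S k) ^ p ≤
      B * ∑ j ∈ Finset.range k, (D j * geomAvg D j + D j ^ 2) := by
    intro k
    induction k with
    | zero =>
      intro _
      simp [hS, lpn_zero hp0, Real.zero_rpow hp0.ne']
    | succ k ih =>
      intro hk
      have e : S (k + 1) = S k + corr (κ k) (d k) := by
        simp only [hS]; rw [Finset.sum_range_succ]
      have h1 := lpn_add_corr_rpow_le hp (hκ k) (hd k) (hSb k) (geomAvg_nonneg hD0 k) hA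
        (by positivity) (lpn_sum_corr_sub_le hp hκ hd k)
        (hmax k (by simp; omega)) (by rw [← e]; exact hmax (k + 1) (by simp; omega))
      rw [← e] at h1
      rw [Finset.sum_range_succ, mul_add]
      exact h1.trans (add_le_add (ih (by omega)) le_rfl)
  have hmn : m ≤ n := by simp at hm; omega
  have hsum : ∑ j ∈ Finset.range m, (D j * geomAvg D j + D j ^ 2) ≤
      2 * ∑ k ∈ Finset.range n, D k ^ 2 := by
    rw [Finset.sum_add_distrib]
    have h1 := sum_mul_geomAvg_le D m
    have h2 : ∑ k ∈ Finset.range m, D k ^ 2 ≤ ∑ k ∈ Finset.range n, D k ^ 2 :=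
      Finset.sum_le_sum_of_subset_of_nonneg (by simpa using hmn) fun _ _ _ => sq_nonneg _
    nlinarith [sq_nonneg (geomAvg D m)]
  have hXp : X ^ p ≤ B * (2 * ∑ k ∈ Finset.range n, D k ^ 2) :=
    (hstep m hmn).trans (mul_le_mul_of_nonneg_left hsum hB0)
  have hn : lpn p (S n) ≤ X := hmax n (by simp)
  have hR : 0 ≤ 2 * p ^ 2 * 3 ^ (p - 2) * A ^ 2 * ∑ k ∈ Finset.range n, D k ^ 2 :=
    mul_nonneg (by positivity) (Finset.sum_nonneg fun _ _ => sq_nonneg _)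
  refine (pow_le_pow_left₀ (lpn_nonneg _ _) hn 2).trans ?_
  rcases hX0.eq_or_lt with h0 | h0
  · rw [← h0]; simpa using hR
  · have e : X ^ p = X ^ (p - 2) * X ^ 2 := by
      rw [← Real.rpow_natCast, ← Real.rpow_add h0]
      norm_num
    rw [e, hB, Real.mul_rpow (by norm_num) hX0] at hXp
    refine le_of_mul_le_mul_left (hXp.trans (le_of_eq (by ring))) (by positivity : 0 < X ^ (p - 2))

lemma integral_pow_mul_comp_smul (g : E3 → ℝ) {N : ℝ} (hN : 0 < N) :
    ∫ x, N ^ 3 * g (N • x) = ∫ x, g x := by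
  rw [integral_const_mul, Measure.integral_comp_smul]
  simp only [finrank_euclideanSpace, Fintype.card_fin, smul_eq_mul]
  rw [abs_of_pos (by positivity), mul_inv_cancel_left₀ (by positivity)]

lemma integral_schwartz_translate_sub_le (κ : 𝓢(E3, ℂ)) (y : E3) :
    ∫ x, ‖κ (x + y) - κ x‖ ≤ (∫ x, ‖fderiv ℝ κ x‖) * ‖y‖ := by
  have hD : Continuous (fderiv ℝ κ) := (SchwartzMap.fderivCLM ℝ E3 ℂ κ).continuous
  have hDi : Integrable (fderiv ℝ κ) := (SchwartzMap.fderivCLM ℝ E3 ℂ κ).integrable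
  have hpt : ∀ x, ‖κ (x + y) - κ x‖ₑ ≤
      ∫⁻ t in Ioc (0 : ℝ) 1, ‖fderiv ℝ κ (x + t • y)‖ₑ * ‖y‖ₑ := by
    intro x
    have h1 : ∫ t in (0 : ℝ)..1, fderiv ℝ κ (x + t • y) y = κ (x + y) - κ x := by
      have := intervalIntegral.integral_eq_sub_of_hasDerivAt (a := 0) (b := 1)
        (f := fun t : ℝ => κ (x + t • y)) (f' := fun t => fderiv ℝ κ (x + t • y) y)
        (fun t _ => by
          have h2 : HasDerivAt (fun t : ℝ => x + t • y) y t := by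
            simpa using ((hasDerivAt_id t).smul_const y).const_add x
          exact (κ.differentiableAt (x := x + t • y)).hasFDerivAt.comp_hasDerivAt t h2)
        (Continuous.intervalIntegrable (by fun_prop) _ _)
      simpa using this
    rw [← h1, intervalIntegral.integral_of_le zero_le_one]
    refine (enorm_integral_le_lintegral_enorm _).trans (lintegral_mono fun t => ?_)
    exact ContinuousLinearMap.le_opENorm _ _
  have hmain : ∫⁻ x, ‖κ (x + y) - κ x‖ₑ ≤ (∫⁻ x, ‖fderiv ℝ κ x‖ₑ) * ‖y‖ₑ := by
    refine (lintegral_mono hpt).trans (le_of_eq ?_)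
    rw [lintegral_lintegral_swap]
    · have : ∀ t : ℝ, ∫⁻ x, ‖fderiv ℝ κ (x + t • y)‖ₑ * ‖y‖ₑ =
          (∫⁻ x, ‖fderiv ℝ κ x‖ₑ) * ‖y‖ₑ := fun t => by
        rw [lintegral_mul_const _ (by fun_prop),
          lintegral_add_right_eq_self (fun x => ‖fderiv ℝ κ x‖ₑ)]
      simp [this]
    · have hc : Continuous fun w : E3 × ℝ => fderiv ℝ κ (w.1 + w.2 • y) := by fun_prop
      exact (hc.enorm.measurable.mul_const _).aemeasurable
  have hi : Integrable fun x => κ (x + y) - κ x :=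
    (κ.integrable.comp_add_right y).sub κ.integrable
  have h3 : ENNReal.ofReal (∫ x, ‖κ (x + y) - κ x‖) ≤
      ENNReal.ofReal ((∫ x, ‖fderiv ℝ κ x‖) * ‖y‖) := by
    rw [ENNReal.ofReal_mul (integral_nonneg fun _ => norm_nonneg _),
      ofReal_integral_norm_eq_lintegral_enorm hi, ofReal_integral_norm_eq_lintegral_enorm hDi,
      ofReal_norm]
    exact hmain
  exact (ENNReal.ofReal_le_ofReal_iff (mul_nonneg (integral_nonneg fun _ => norm_nonneg _)
    (norm_nonneg _))).1 h3

lemma bddInt_schwartz (κ : 𝓢(E3, ℂ)) : BddInt κ where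
  measurable := κ.continuous.measurable
  integrable := κ.integrable
  bounded := ⟨_, fun x => SchwartzMap.norm_le_seminorm ℝ κ x⟩

/-- Rescalings of a mean-zero Schwartz function are uniformly good kernels. -/
lemma exists_goodKernel (κ : 𝓢(E3, ℂ)) (h0 : ∫ x, κ x = 0) :
    ∃ A : ℝ, 0 ≤ A ∧ ∀ N : ℝ, 0 < N →
      GoodKernel (fun x => ((N ^ 3 : ℝ) : ℂ) * κ (N • x)) A N := by
  have hm : Integrable fun x => ‖κ x‖ * ‖x‖ :=
    (κ.integrable_pow_mul volume 1).congr (Filter.Eventually.of_forall fun x => by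
      simp [mul_comm])
  set a := ∫ x, ‖κ x‖ with ha
  set b := ∫ x, ‖κ x‖ * ‖x‖ with hb
  set c := ∫ x, ‖fderiv ℝ κ x‖ with hc
  have ha0 : 0 ≤ a := integral_nonneg fun _ => norm_nonneg _
  have hb0 : 0 ≤ b := integral_nonneg fun _ => by positivity
  have hc0 : 0 ≤ c := integral_nonneg fun _ => norm_nonneg _
  refine ⟨a + b + c, by positivity, fun N hN => ?_⟩
  have hn : ∀ w : ℂ, ‖((N ^ 3 : ℝ) : ℂ) * w‖ = N ^ 3 * ‖w‖ := fun w => by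
    rw [norm_mul, Complex.norm_real, Real.norm_of_nonneg (by positivity)]
  have hmom : ∀ z : E3, ‖((N ^ 3 : ℝ) : ℂ) * κ (N • z)‖ * ‖z‖ =
      N⁻¹ * (N ^ 3 * (‖κ (N • z)‖ * ‖N • z‖)) := fun z => by
    rw [hn, norm_smul, Real.norm_of_nonneg hN.le]; field_simp
  have hκ := bddInt_schwartz κ
  exact
    { bddInt :=
        { measurable := (hκ.measurable.comp (measurable_const_smul N)).const_mul _
          integrable := (hκ.integrable.comp_smul hN.ne').const_mul _
          bounded := by
            obtain ⟨C, hC⟩ := hκ.bounded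
            exact ⟨N ^ 3 * C, fun x => by rw [hn]; gcongr; exact hC _⟩ }
      norm_le := by
        simp_rw [hn]
        rw [integral_pow_mul_comp_smul (fun x => ‖κ x‖) hN]
        linarith
      integral_eq_zero := by
        rw [integral_const_mul, Measure.integral_comp_smul, h0]
        simp
      integrable_moment := by
        simp_rw [hmom]
        exact ((hm.comp_smul hN.ne').const_mul _).const_mul _
      moment_le := by
        simp_rw [hmom]
        rw [integral_const_mul, integral_pow_mul_comp_smul (fun x => ‖κ x‖ * ‖x‖) hN,
          inv_mul_eq_div]
        gcongr
        linarith
      translate_le := fun h => by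
        simp_rw [← mul_sub, hn, smul_add]
        rw [integral_pow_mul_comp_smul (fun x => ‖κ (x + N • h) - κ x‖) hN]
        refine (integral_schwartz_translate_sub_le κ (N • h)).trans ?_
        rw [norm_smul, Real.norm_of_nonneg hN.le, mul_assoc]
        gcongr
        linarith }

/-- An extremiser for the `L^q`–`L^p` duality at a Schwartz function. -/
lemma exists_dual_schwartz {p : ℝ} (hp : 2 < p) (H : 𝓢(E3, ℂ)) :
    ∃ d : E3 → ℂ, BddInt d ∧ lpn p d = lpn (p / (p - 1)) H ∧
      ∫ x, d x * H x = ((lpn (p / (p - 1)) H ^ 2 : ℝ) : ℂ) := by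
  set q := p / (p - 1) with hq
  have hp1 : 0 < p - 1 := by linarith
  have hp0 : 0 < p := by linarith
  have hq1 : 1 < q := by rw [hq, lt_div_iff₀ hp1]; linarith
  have hq2 : q < 2 := by rw [hq, div_lt_iff₀ hp1]; linarith
  have hq10 : 0 < q - 1 := by linarith
  have hqp : (q - 1) * p = q := by rw [hq]; field_simp; ring
  set h := lpn q H with hh
  have hh0 : 0 ≤ h := lpn_nonneg _ _
  set c : ℂ := ((h ^ (2 - q) : ℝ) : ℂ) with hc
  have hHb := bddInt_schwartz H
  obtain ⟨B, hB⟩ := hHb.bounded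
  have hnorm : ∀ x, ‖dualFun q H x‖ = ‖H x‖ ^ (q - 1) := fun x => by
    rw [norm_dualFun]
    rcases (norm_nonneg (H x)).eq_or_lt with h0 | h0
    · rw [← h0, mul_zero, Real.zero_rpow hq10.ne']
    · rw [← Real.rpow_add_one h0.ne']; ring_nf
  have hmeas : Measurable (dualFun q H) :=
    (Complex.measurable_ofReal.comp (hHb.measurable.norm.pow_const _)).mul
      (Complex.continuous_conj.measurable.comp hHb.measurable)
  have hint : Integrable fun x => ‖H x‖ ^ (q - 1) := by
    have := (H.memLp (ENNReal.ofReal (q - 1))).integrable_norm_rpow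
      (by simpa using hq10) ENNReal.ofReal_ne_top
    rwa [ENNReal.toReal_ofReal hq10.le] at this
  have hdb : BddInt (dualFun q H) :=
    { measurable := hmeas
      integrable := hint.mono' hmeas.aestronglyMeasurable
        (Filter.Eventually.of_forall fun x => (hnorm x).le)
      bounded := ⟨B ^ (q - 1), fun x => by
        rw [hnorm]; exact Real.rpow_le_rpow (norm_nonneg _) (hB x) hq10.le⟩ }
  have hcn : ‖c‖ = h ^ (2 - q) := by
    rw [hc, Complex.norm_real, Real.norm_of_nonneg (by positivity)]
  have hqpos : 0 < q := by linarith
  have h2q : 0 < 2 - q := by linarith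
  refine ⟨fun x => c * dualFun q H x,
    hdb.mul_of_bdd measurable_const (C := ‖c‖) fun _ => le_rfl, ?_, ?_⟩
  · have e : ∀ x, ‖c * dualFun q H x‖ ^ p = (h ^ (2 - q)) ^ p * ‖H x‖ ^ q := fun x => by
      rw [norm_mul, hcn, hnorm, Real.mul_rpow (by positivity) (by positivity),
        ← Real.rpow_mul (norm_nonneg _), hqp]
    rw [lpn]
    simp_rw [e]
    rw [integral_const_mul, ← lpn_rpow hqpos, ← hh, ← Real.rpow_mul hh0,
      ← Real.rpow_add' hh0 (by positivity), ← Real.rpow_mul hh0]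
    have : ((2 - q) * p + q) * (1 / p) = 1 := by
      have : (2 - q) * p + q = p := by linarith
      rw [this]; field_simp
    rw [this, Real.rpow_one]
  · have e : ∀ x, c * dualFun q H x * H x = c * ((‖H x‖ ^ q : ℝ) : ℂ) := fun x => by
      rw [mul_assoc, dualFun_mul_self hqpos]
    simp_rw [e]
    rw [integral_const_mul, integral_complex_ofReal, ← lpn_rpow hqpos, ← hh, hc,
      ← Complex.ofReal_mul, ← Real.rpow_add' hh0 (by norm_num), ← Real.rpow_natCast]
    norm_num

lemma sq_le_mul_sq_of_sq_le {E : ℝ≥0∞} {Y c : ℝ} (hY : 0 ≤ Y) (hc : 0 ≤ c)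
    (h : ENNReal.ofReal (Y ^ 2) ≤ E * ENNReal.ofReal (c * Y)) :
    ENNReal.ofReal (Y ^ 2) ≤ ENNReal.ofReal (c ^ 2) * E ^ 2 := by
  rcases hY.eq_or_lt with rfl | hY
  · simp
  rw [sq, ENNReal.ofReal_mul hY.le, ENNReal.ofReal_mul hc, ← mul_assoc,
    ENNReal.mul_le_mul_iff_left (by simpa using hY) ENNReal.ofReal_ne_top] at h
  rw [ENNReal.ofReal_pow hY.le, ENNReal.ofReal_pow hc, ← mul_pow, mul_comm (ENNReal.ofReal c)]
  gcongr

/-- Finite dyadic square sums of Littlewood–Paley pieces, in `L^q` with `q < 2`. -/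
lemma exists_sum_sq_le {p : ℝ} (hp : 2 < p) (ψ : 𝓢(E3, ℂ)) (hψ : ψ 0 = 0) :
    ∃ C : ℝ≥0, ∀ g : E3 → ℂ, Integrable g → ∀ l : ℝ, 0 < l → ∀ H : ℕ → 𝓢(E3, ℂ),
      (∀ k, ⇑(H k) = 𝓕⁻ (fun ξ => ψ ((l * 2 ^ k)⁻¹ • ξ) * g ξ)) → ∀ n : ℕ,
      ∑ k ∈ Finset.range n, eLpNorm (H k) (ENNReal.ofReal (p / (p - 1))) volume ^ 2 ≤
        C * eLpNorm (𝓕⁻ g) (ENNReal.ofReal (p / (p - 1))) volume ^ 2 := by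
  have hp1 : 0 < p - 1 := by linarith
  have hp0 : 0 < p := by linarith
  have h0 : ∫ x, (𝓕⁻ ψ) x = 0 := by
    have h1 : 𝓕 (⇑(𝓕⁻ ψ : 𝓢(E3, ℂ))) 0 = 0 := by
      rw [← SchwartzMap.fourier_coe, FourierTransform.fourier_fourierInv_eq, hψ]
    rwa [Real.fourier_eq', integral_congr_ae (g := fun x => (𝓕⁻ ψ) x)
      (Filter.Eventually.of_forall fun x => by simp)] at h1
  obtain ⟨A, hA, hgood⟩ := exists_goodKernel (𝓕⁻ ψ) h0
  set q := p / (p - 1) with hq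
  have hq1 : 1 < q := by rw [hq, lt_div_iff₀ hp1]; linarith
  set c := √(2 * p ^ 2 * 3 ^ (p - 2) * A ^ 2) with hc
  refine ⟨Real.toNNReal (c ^ 2), fun g hg l hl H hH n => ?_⟩
  set κ : ℕ → E3 → ℂ := fun k x => (((l * 2 ^ k) ^ 3 : ℝ) : ℂ) * (𝓕⁻ ψ) ((l * 2 ^ k) • x) with hκ
  have hκg : ∀ k, GoodKernel (κ k) A (l * 2 ^ k) := fun k => hgood _ (by positivity)
  have hκF : ∀ k, 𝓕 (κ k) = fun ξ => ψ ((l * 2 ^ k)⁻¹ • ξ) := by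
    intro k
    have hk : 0 < l * 2 ^ k := by positivity
    have e : κ k = 𝓕⁻ (fun ξ => ψ ((l * 2 ^ k)⁻¹ • ξ)) := by
      ext x
      rw [fourierInv_comp_smul _ hk, ← SchwartzMap.fourierInv_coe]
    have hc' : Continuous fun ξ => ψ ((l * 2 ^ k)⁻¹ • ξ) :=
      ψ.continuous.comp (continuous_const_smul _)
    have hi := ψ.integrable (μ := volume).comp_smul (inv_ne_zero hk.ne')
    rw [e]
    refine hc'.fourier_fourierInv_eq hi ?_
    have := (hκg k).bddInt.integrable
    rw [e] at this
    have h2 := this.comp_neg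
    refine h2.congr (Filter.Eventually.of_forall fun x => ?_)
    simp [Real.fourierInv_eq_fourier_neg]
  set f := 𝓕⁻ g with hf
  have hfc : Continuous f := continuous_fourierInv hg
  have hfb : ∀ x, ‖f x‖ ≤ ∫ ξ, ‖g ξ‖ := fun x => by
    rw [hf, Real.fourierInv_eq_fourier_neg]
    exact VectorFourier.norm_fourierIntegral_le_integral_norm _ _ _ _ _
  have hHf : ∀ k x, ∫ z, f (x - z) * κ k z = H k x := fun k x => by
    rw [hf, integral_fourierInv_sub_mul hg (hκg k).bddInt.integrable, hκF, hH]
    simp_rw [mul_comm]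
  choose d hdb hdn hdi using fun k => exists_dual_schwartz hp (H k)
  set S := ∑ k ∈ Finset.range n, corr (κ k) (d k) with hS
  have hSb : BddInt S := BddInt.sum _ fun k _ => (hκg k).bddInt.corr (hdb k)
  have hty := lpn_sum_corr_sq_le hp hA hl hκg hdb n
  simp_rw [hdn] at hty
  set Y2 := ∑ k ∈ Finset.range n, lpn q (H k) ^ 2 with hY2
  have hY20 : 0 ≤ Y2 := Finset.sum_nonneg fun _ _ => sq_nonneg _
  have hSl : lpn p S ≤ c * √Y2 := by
    rw [hc, ← Real.sqrt_mul (by positivity)]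
    exact Real.le_sqrt_of_sq_le hty
  have hpair : ((Y2 : ℝ) : ℂ) = ∫ y, f y * S y := by
    rw [hS, hY2]
    have hi : ∀ k, Integrable fun y => f y * corr (κ k) (d k) y := fun k =>
      ((hκg k).bddInt.corr (hdb k)).integrable.bdd_mul hfc.aestronglyMeasurable
        (Filter.Eventually.of_forall hfb)
    simp_rw [Finset.sum_apply, Finset.mul_sum]
    rw [integral_finsetSum _ fun k _ => hi k, Complex.ofReal_sum]
    refine Finset.sum_congr rfl fun k _ => ?_
    rw [integral_mul_corr_eq (hκg k).bddInt (hdb k) hfc.measurable hfb, ← hdi k]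
    simp_rw [hHf]
  have hE : ENNReal.ofReal Y2 ≤ eLpNorm f (ENNReal.ofReal q) volume * ENNReal.ofReal (c * √Y2) := by
    have h1 : ENNReal.ofReal Y2 ≤ ∫⁻ y, ‖f y‖ₑ * ‖S y‖ₑ := by
      have := enorm_integral_le_lintegral_enorm (μ := volume) fun y => f y * S y
      rw [← hpair, ← ofReal_norm, Complex.norm_real, Real.norm_of_nonneg hY20] at this
      simpa [enorm_mul] using this
    have hconj : q.HolderConjugate p := by
      rw [Real.holderConjugate_iff]
      exact ⟨hq1, by rw [hq]; field_simp; ring⟩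
    have h2 := ENNReal.lintegral_mul_le_Lp_mul_Lq volume hconj
      hfc.measurable.enorm.aemeasurable hSb.measurable.enorm.aemeasurable
    have e : ∀ {r : ℝ} (w : E3 → ℂ), 0 < r →
        (∫⁻ x, ‖w x‖ₑ ^ r) ^ (1 / r) = eLpNorm w (ENNReal.ofReal r) volume := fun w hr => by
      rw [eLpNorm_eq_lintegral_rpow_enorm_toReal (by simpa using hr) ENNReal.ofReal_ne_top,
        ENNReal.toReal_ofReal hr.le]
    rw [e f (by linarith), e S hp0, hSb.eLpNorm_eq_lpn (by linarith : (1 : ℝ) ≤ p)] at h2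
    refine h1.trans (h2.trans ?_)
    gcongr
  have hfin := sq_le_mul_sq_of_sq_le (Real.sqrt_nonneg Y2) (Real.sqrt_nonneg _)
    (by rw [Real.sq_sqrt hY20]; exact hE)
  rw [Real.sq_sqrt hY20] at hfin
  refine le_trans (le_of_eq ?_) hfin
  rw [hY2, ENNReal.ofReal_sum_of_nonneg fun _ _ => sq_nonneg _]
  refine Finset.sum_congr rfl fun k _ => ?_
  rw [(bddInt_schwartz (H k)).eLpNorm_eq_lpn hq1.le, ENNReal.ofReal_pow (lpn_nonneg _ _)]

/-- The symbol of the Littlewood–Paley projection at frequency `1`. -/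
def lpSymbol (φ : E3 → ℝ) (ξ : E3) : ℂ := ((φ ξ - φ ((2 : ℝ) • ξ) : ℝ) : ℂ)

lemma IsLPBump3.lpSymbol_eq_zero_of_le {φ : E3 → ℝ} (hφ : IsLPBump3 φ) {ξ : E3}
    (h : ‖ξ‖ ≤ 1 / 2) : lpSymbol φ ξ = 0 := by
  rw [lpSymbol, hφ.eq_one ξ (by linarith), hφ.eq_one ((2 : ℝ) • ξ) (by
    rw [norm_smul, Real.norm_of_nonneg zero_le_two]; linarith)]
  simp

lemma IsLPBump3.lpSymbol_eq_zero_of_ge {φ : E3 → ℝ} (hφ : IsLPBump3 φ) {ξ : E3}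
    (h : 2 ≤ ‖ξ‖) : lpSymbol φ ξ = 0 := by
  rw [lpSymbol, hφ.eq_zero ξ h, hφ.eq_zero ((2 : ℝ) • ξ) (by
    rw [norm_smul, Real.norm_of_nonneg zero_le_two]; linarith)]
  simp

lemma IsLPBump3.contDiff_lpSymbol {φ : E3 → ℝ} (hφ : IsLPBump3 φ) :
    ContDiff ℝ (⊤ : ℕ∞) (lpSymbol φ) :=
  Complex.ofRealCLM.contDiff.comp
    (hφ.smooth.sub (hφ.smooth.comp (contDiff_const_smul (2 : ℝ))))

lemma IsLPBump3.hasCompactSupport_lpSymbol {φ : E3 → ℝ} (hφ : IsLPBump3 φ) :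
    HasCompactSupport (lpSymbol φ) :=
  HasCompactSupport.intro (isCompact_closedBall (0 : E3) 2) fun ξ hξ =>
    hφ.lpSymbol_eq_zero_of_ge (by
      rw [mem_closedBall_zero_iff] at hξ
      linarith)

lemma norm_inv_smul {N : ℝ} (hN : 0 < N) (ξ : E3) : ‖N⁻¹ • ξ‖ = ‖ξ‖ / N := by
  rw [norm_smul, norm_inv, Real.norm_of_nonneg hN.le]
  ring

lemma IsLPBump3.exists_schwartz_piece {φ : E3 → ℝ} (hφ : IsLPBump3 φ) {g : E3 → ℂ}
    (hg : ∀ ξ, ξ ≠ 0 → ContDiffAt ℝ (⊤ : ℕ∞) g ξ) {N : ℝ} (hN : 0 < N) :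
    ∃ H : 𝓢(E3, ℂ), ⇑H = 𝓕⁻ (fun ξ => lpSymbol φ (N⁻¹ • ξ) * g ξ) ∧
      𝓕 ⇑H = fun ξ => lpSymbol φ (N⁻¹ • ξ) * g ξ := by
  have hsm : ContDiff ℝ (⊤ : ℕ∞) fun ξ => lpSymbol φ (N⁻¹ • ξ) * g ξ := by
    rw [contDiff_iff_contDiffAt]
    intro ξ
    by_cases h : ξ = 0
    · refine (contDiffAt_const (c := (0 : ℂ))).congr_of_eventuallyEq ?_
      filter_upwards [ball_mem_nhds ξ (by positivity : 0 < N / 2)] with η hη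
      rw [h, mem_ball_zero_iff] at hη
      rw [hφ.lpSymbol_eq_zero_of_le, zero_mul]
      rw [norm_inv_smul hN, div_le_iff₀ hN]
      linarith
    · exact (hφ.contDiff_lpSymbol.comp (contDiff_const_smul N⁻¹)).contDiffAt.mul (hg ξ h)
  have hcs : HasCompactSupport fun ξ => lpSymbol φ (N⁻¹ • ξ) * g ξ :=
    HasCompactSupport.intro (isCompact_closedBall (0 : E3) (2 * N)) fun ξ hξ => by
      rw [mem_closedBall_zero_iff, not_le] at hξ
      rw [hφ.lpSymbol_eq_zero_of_ge, zero_mul]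
      rw [norm_inv_smul hN, le_div_iff₀ hN]
      exact hξ.le
  set m : 𝓢(E3, ℂ) := hcs.toSchwartzMap hsm with hm
  have hmc : ⇑m = fun ξ => lpSymbol φ (N⁻¹ • ξ) * g ξ := rfl
  refine ⟨(𝓕⁻ m : 𝓢(E3, ℂ)), ?_, ?_⟩
  · rw [SchwartzMap.fourierInv_coe, hmc]
  · rw [← SchwartzMap.fourier_coe, FourierTransform.fourier_fourierInv_eq, hmc]

lemma IsLPBump3.exists_tsum_le {φ : E3 → ℝ} (hφ : IsLPBump3 φ) {β : ℝ → ℝ} {a b : ℝ}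
    (hβ : AnnularBump β a b) {p : ℝ} (hp : 2 < p) :
    ∃ C : ℝ≥0, ∀ g : E3 → ℂ, Integrable g → (∀ ξ, ξ ≠ 0 → ContDiffAt ℝ (⊤ : ℕ∞) g ξ) →
      ∀ θ : ℝ, ∑' n : ℤ, (⨆ t ∈ Ici (0 : ℝ),
        ENNReal.ofReal (((1 + t * (2 : ℝ) ^ n) / (2 : ℝ) ^ n) ^ (1 - 2 / p)) *
          eLpNorm (𝓕⁻ (fun ξ => ((((2 : ℝ) ^ n) ^ (-(2 - 4 / p)) : ℝ) : ℂ) *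
            (waveSymbol β (t * (2 : ℝ) ^ n) θ (((2 : ℝ) ^ n)⁻¹ • ξ) *
              (lpSymbol φ (((2 : ℝ) ^ n)⁻¹ • ξ) * g ξ)))) (ENNReal.ofReal p) volume) ^ 2 ≤
        C * eLpNorm (𝓕⁻ g) (ENNReal.ofReal (p / (p - 1))) volume ^ 2 := by
  obtain ⟨C₁, hC₁⟩ := hβ.exists_weighted_le hp
  obtain ⟨C₂, hC₂⟩ := exists_sum_sq_le hp
    (hφ.hasCompactSupport_lpSymbol.toSchwartzMap hφ.contDiff_lpSymbol)
    (hφ.lpSymbol_eq_zero_of_le (by simp))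
  refine ⟨C₁ ^ 2 * C₂, fun g hgi hg θ => ?_⟩
  choose H hH hHF using fun n : ℤ =>
    hφ.exists_schwartz_piece hg (zpow_pos (zero_lt_two' ℝ) n)
  have hle : ∀ n : ℤ, (⨆ t ∈ Ici (0 : ℝ),
        ENNReal.ofReal (((1 + t * (2 : ℝ) ^ n) / (2 : ℝ) ^ n) ^ (1 - 2 / p)) *
          eLpNorm (𝓕⁻ (fun ξ => ((((2 : ℝ) ^ n) ^ (-(2 - 4 / p)) : ℝ) : ℂ) *
            (waveSymbol β (t * (2 : ℝ) ^ n) θ (((2 : ℝ) ^ n)⁻¹ • ξ) *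
              (lpSymbol φ (((2 : ℝ) ^ n)⁻¹ • ξ) * g ξ)))) (ENNReal.ofReal p) volume) ^ 2 ≤
      C₁ ^ 2 * eLpNorm (H n) (ENNReal.ofReal (p / (p - 1))) volume ^ 2 := fun n => by
    rw [← mul_pow]
    refine pow_le_pow_left' (iSup₂_le fun t ht => ?_) 2
    have := hC₁ ((2 : ℝ) ^ n) t θ (zpow_pos zero_lt_two n) ht (H n) (bddInt_schwartz (H n))
    rwa [hHF n] at this
  refine (ENNReal.tsum_le_tsum hle).trans ?_
  rw [ENNReal.tsum_mul_left, ENNReal.coe_mul, ENNReal.coe_pow, mul_assoc]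
  gcongr
  rw [ENNReal.tsum_eq_iSup_sum]
  refine iSup_le fun s => ?_
  obtain ⟨n₀, hn₀⟩ := s.bddBelow
  obtain ⟨n₁, hn₁⟩ := s.bddAbove
  have hsub : s ⊆ (Finset.range (n₁ - n₀ + 1).toNat).image fun k : ℕ => n₀ + (k : ℤ) := by
    intro n hn
    have h0 := hn₀ (Finset.mem_coe.2 hn)
    have h1 := hn₁ (Finset.mem_coe.2 hn)
    exact Finset.mem_image.2 ⟨(n - n₀).toNat, Finset.mem_range.2 (by omega), by omega⟩
  refine (Finset.sum_le_sum_of_subset hsub).trans ?_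
  rw [Finset.sum_image fun x _ y _ h => by simpa using h]
  refine hC₂ g hgi ((2 : ℝ) ^ n₀) (zpow_pos zero_lt_two n₀) (fun k => H (n₀ + k)) (fun k => ?_) _
  rw [hH, zpow_add₀ two_ne_zero, zpow_natCast]
  rfl

lemma exists_annularBump (s : ℝ) :
    ∃ β : ℝ → ℝ, AnnularBump β (1 / 4) (9 / 4) ∧
      ∀ r ∈ Icc (1 / 2 : ℝ) 2, β r = (2 * Real.pi * r) ^ (-s) := by
  set χ : ContDiffBump (5 / 4 : ℝ) := ⟨3 / 4, 1, by norm_num, by norm_num⟩ with hχ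
  have hz : ∀ r : ℝ, 1 ≤ |r - 5 / 4| → χ r = 0 := fun r hr =>
    χ.zero_of_le_dist (by rw [Real.dist_eq]; exact hr)
  refine ⟨fun r => χ r * (2 * Real.pi * r) ^ (-s), ⟨?_, by norm_num, by norm_num, ?_, ?_⟩, ?_⟩
  · rw [contDiff_iff_contDiffAt]
    intro r
    rcases lt_or_ge 0 r with h | h
    · refine χ.contDiff.contDiffAt.mul ?_
      exact (contDiffAt_const.mul contDiffAt_id).rpow_const_of_ne (by simp; positivity)
    · refine (contDiffAt_const (c := (0 : ℝ))).congr_of_eventuallyEq ?_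
      filter_upwards [Iio_mem_nhds (by linarith : r < 1 / 4)] with x hx
      rw [hz x, zero_mul]
      rw [abs_sub_comm]
      exact le_trans (by have := mem_Iio.1 hx; linarith) (le_abs_self _)
  · intro r hr
    rw [hz r, zero_mul]
    rw [abs_sub_comm]
    exact le_trans (by linarith) (le_abs_self _)
  · intro r hr
    rw [hz r, zero_mul]
    exact le_trans (by linarith) (le_abs_self _)
  · intro r hr
    simp only
    rw [χ.one_of_mem_closedBall, one_mul]
    rw [mem_closedBall, Real.dist_eq, hχ, abs_le]
    exact ⟨by linarith [hr.1], by linarith [hr.2]⟩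

lemma measurable_rpow_norm (σ : ℝ) :
    Measurable fun ξ : E3 => (((2 * Real.pi * ‖ξ‖) ^ σ : ℝ) : ℂ) := by
  fun_prop

lemma contDiffAt_rpow_norm_mul (κ : 𝓢(E3, ℂ)) (σ : ℝ) {ξ : E3} (hξ : ξ ≠ 0) :
    ContDiffAt ℝ (⊤ : ℕ∞) (fun ξ => (((2 * Real.pi * ‖ξ‖) ^ σ : ℝ) : ℂ) * κ ξ) ξ := by
  have hpos : 0 < ‖ξ‖ := norm_pos_iff.2 hξ
  have h : ContDiffAt ℝ (⊤ : ℕ∞) (fun ξ : E3 => (2 * Real.pi * ‖ξ‖) ^ σ) ξ :=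
    (contDiffAt_const.mul (contDiffAt_norm ℝ hξ)).rpow_const_of_ne (by positivity)
  exact (Complex.ofRealCLM.contDiff.contDiffAt.comp ξ h).mul (κ.smooth _).contDiffAt

lemma integrable_rpow_norm_mul (κ : 𝓢(E3, ℂ)) {σ : ℝ} (h3 : -3 < σ) (h2 : σ ≤ 2) :
    Integrable fun ξ => (((2 * Real.pi * ‖ξ‖) ^ σ : ℝ) : ℂ) * κ ξ := by
  have hm : AEStronglyMeasurable (fun ξ => (((2 * Real.pi * ‖ξ‖) ^ σ : ℝ) : ℂ) * κ ξ) volume :=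
    ((measurable_rpow_norm σ).mul κ.continuous.measurable).aestronglyMeasurable
  have hn : ∀ ξ : E3, ‖(((2 * Real.pi * ‖ξ‖) ^ σ : ℝ) : ℂ) * κ ξ‖ =
      (2 * Real.pi) ^ σ * ‖ξ‖ ^ σ * ‖κ ξ‖ := fun ξ => by
    rw [norm_mul, Complex.norm_real, Real.norm_of_nonneg (by positivity),
      Real.mul_rpow (by positivity) (norm_nonneg _)]
  obtain ⟨M, hM⟩ := (bddInt_schwartz κ).bounded
  rw [← integrableOn_univ, ← union_compl_self (ball (0 : E3) 1)]
  refine IntegrableOn.union ?_ ?_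
  · refine integrableOn_ball_of_norm_le_rpow (α := -σ) (C := (2 * Real.pi) ^ σ * M)
      (by simp) (by simp; linarith) (Filter.Eventually.of_forall fun ξ => ?_) hm
    rw [hn, neg_neg, mul_right_comm]
    gcongr
    exact hM ξ
  · refine Integrable.mono' ((κ.integrable_pow_mul volume 2).const_mul
      ((2 * Real.pi) ^ σ)).integrableOn hm.restrict ?_
    filter_upwards [ae_restrict_mem measurableSet_ball.compl] with ξ hξ
    have h1 : 1 ≤ ‖ξ‖ := by simpa using hξ
    rw [hn, mul_assoc, ← Real.rpow_two]
    gcongr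

lemma LPsymbol_mul_waveSymbol {φ : E3 → ℝ} (hφ : IsLPBump3 φ) {β : ℝ → ℝ} {s : ℝ}
    (hβ : ∀ r ∈ Icc (1 / 2 : ℝ) 2, β r = (2 * Real.pi * r) ^ (-s)) {N : ℝ} (hN : 0 < N)
    (t θ σ : ℝ) (K : E3 → ℂ) (ξ : E3) :
    ((N ^ (-s) : ℝ) : ℂ) * (waveSymbol β (t * N) θ (N⁻¹ • ξ) * (lpSymbol φ (N⁻¹ • ξ) *
        ((((2 * Real.pi * ‖ξ‖) ^ σ : ℝ) : ℂ) * K ξ))) =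
      lpSymbol φ (N⁻¹ • ξ) * (((Real.cos (2 * Real.pi * t * ‖ξ‖ + θ) *
        (2 * Real.pi * ‖ξ‖) ^ (σ - s) : ℝ) : ℂ) * K ξ) := by
  by_cases h0 : lpSymbol φ (N⁻¹ • ξ) = 0
  · simp [h0]
  have h1 : 1 / 2 < ‖ξ‖ / N := by
    by_contra! h
    exact h0 (hφ.lpSymbol_eq_zero_of_le (by rwa [norm_inv_smul hN]))
  have h2 : ‖ξ‖ / N < 2 := by
    by_contra! h
    exact h0 (hφ.lpSymbol_eq_zero_of_ge (by rwa [norm_inv_smul hN]))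
  have hξ : 0 < ‖ξ‖ := by
    rw [lt_div_iff₀ hN] at h1
    linarith
  have e1 : N ^ (-s) * β (‖ξ‖ / N) * (2 * Real.pi * ‖ξ‖) ^ σ =
      (2 * Real.pi * ‖ξ‖) ^ (σ - s) := by
    rw [hβ _ ⟨h1.le, h2.le⟩, ← Real.mul_rpow hN.le (by positivity),
      show N * (2 * Real.pi * (‖ξ‖ / N)) = 2 * Real.pi * ‖ξ‖ by field_simp,
      ← Real.rpow_add (by positivity)]
    congr 1
    ring
  rw [waveSymbol, norm_inv_smul hN,
    show 2 * Real.pi * (t * N) * (‖ξ‖ / N) = 2 * Real.pi * t * ‖ξ‖ by field_simp, ← e1]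
  push_cast
  ring

lemma fourierInv_add {f g : E3 → ℂ} (hf : Integrable f) (hg : Integrable g) :
    𝓕⁻ (fun ξ => f ξ + g ξ) = 𝓕⁻ f + 𝓕⁻ g := by
  ext x
  have hb : ∀ {f : E3 → ℂ}, Integrable f →
      Integrable fun v => Real.fourierChar (inner ℝ v x) • f v := fun hf => by
    refine hf.mono (AEStronglyMeasurable.smul (f := fun v : E3 => Real.fourierChar (inner ℝ v x))
      ?_ hf.1) (Filter.Eventually.of_forall fun v => by simp)
    exact (Real.continuous_fourierChar.comp (by fun_prop)).aestronglyMeasurable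
  simp only [Pi.add_apply, Real.fourierInv_eq, smul_add]
  exact integral_add (hb hf) (hb hg)

lemma integrable_ofReal_mul {m : E3 → ℝ} (hm : Measurable m) {B : ℝ} (hB : ∀ ξ, |m ξ| ≤ B)
    (K : 𝓢(E3, ℂ)) : Integrable fun ξ => ((m ξ : ℝ) : ℂ) * K ξ :=
  K.integrable.bdd_mul (c := B) (Complex.measurable_ofReal.comp hm).aestronglyMeasurable
    (Filter.Eventually.of_forall fun ξ => by
      rw [Complex.norm_real]
      exact hB ξ)

lemma abs_sin_div_le (t r : ℝ) :
    |Real.sin (2 * Real.pi * t * r) / (2 * Real.pi * r)| ≤ |t| := by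
  rw [abs_div]
  refine div_le_of_le_mul₀ (abs_nonneg _) (abs_nonneg _) ?_
  rw [← abs_mul]
  refine Real.abs_sin_le_abs.trans (le_of_eq ?_)
  congr 1
  ring

lemma IsLPBump3.integrable_lpSymbol_mul {φ : E3 → ℝ} (hφ : IsLPBump3 φ) (N : ℝ) {h : E3 → ℂ}
    (hh : Integrable h) : Integrable fun ξ => lpSymbol φ (N⁻¹ • ξ) * h ξ := by
  refine hh.bdd_mul (c := 1) ?_ (Filter.Eventually.of_forall fun ξ => ?_)
  · exact (hφ.contDiff_lpSymbol.continuous.comp (continuous_const_smul N⁻¹)).aestronglyMeasurable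
  · have h1 := hφ.mem_Icc (N⁻¹ • ξ)
    have h2 := hφ.mem_Icc ((2 : ℝ) • N⁻¹ • ξ)
    rw [lpSymbol, Complex.norm_real, Real.norm_eq_abs, abs_le]
    exact ⟨by linarith [h1.1, h2.2], by linarith [h1.2, h2.1]⟩

lemma IsLPBump3.LP3_fourierInv {φ : E3 → ℝ} (hφ : IsLPBump3 φ) (N : ℝ) {h : E3 → ℂ}
    (hh : Integrable h) (hc : ∀ ξ, ξ ≠ 0 → ContinuousAt h ξ) :
    LP3 φ N (𝓕⁻ h) = 𝓕⁻ (fun ξ => lpSymbol φ (N⁻¹ • ξ) * h ξ) ∨ LP3 φ N (𝓕⁻ h) = 0 := by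
  have hsym : ∀ ξ : E3, ((φ (N⁻¹ • ξ) - φ ((2 / N) • ξ) : ℝ) : ℂ) = lpSymbol φ (N⁻¹ • ξ) :=
    fun ξ => by rw [lpSymbol, smul_smul, div_eq_mul_inv]
  by_cases hi : Integrable (𝓕⁻ h)
  · left
    have hi' : Integrable (𝓕 h) := by
      refine hi.comp_neg.congr (Filter.Eventually.of_forall fun x => ?_)
      simp [Real.fourierInv_eq_fourier_neg]
    simp only [LP3, fmul3, hsym]
    refine congrArg _ (funext fun ξ => ?_)
    by_cases h0 : ξ = 0
    · rw [h0, hφ.lpSymbol_eq_zero_of_le (by simp), zero_mul, zero_mul]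
    · rw [hh.fourier_fourierInv_eq hi' (hc ξ h0)]
  · right
    have hz : 𝓕 (𝓕⁻ h) = 0 := by
      ext ξ
      rw [Real.fourier_eq]
      refine integral_undef fun hcon => hi ?_
      exact (Real.fourierIntegral_convergent_iff ξ).1 hcon
    simp only [LP3, fmul3, hz]
    ext x
    simp [Real.fourierInv_eq]

lemma exists_schwartz_fourier_rc (u : 𝓢(E3, ℝ)) : ∃ K : 𝓢(E3, ℂ), 𝓕 (rc ⇑u) = ⇑K :=
  ⟨𝓕 (u.postcompCLM Complex.ofRealCLM), by
    rw [SchwartzMap.fourier_coe]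
    rfl⟩

lemma IsLPBump3.eLpNorm_LP3_le {φ : E3 → ℝ} (hφ : IsLPBump3 φ) {β : ℝ → ℝ} {s : ℝ}
    (hβ : ∀ r ∈ Icc (1 / 2 : ℝ) 2, β r = (2 * Real.pi * r) ^ (-s)) {N : ℝ} (hN : 0 < N)
    {q : ℝ≥0∞} (hq : 1 ≤ q) (t : ℝ) {f₀ f₁ : E3 → ℂ} {K₀ K₁ : 𝓢(E3, ℂ)} (h₀ : 𝓕 f₀ = ⇑K₀)
    (h₁ : 𝓕 f₁ = ⇑K₁) :
    eLpNorm (LP3 φ N (fun x => cosProp3 t f₀ x + sinProp3 t f₁ x)) q volume ≤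
      eLpNorm (𝓕⁻ (fun ξ => ((N ^ (-s) : ℝ) : ℂ) * (waveSymbol β (t * N) 0 (N⁻¹ • ξ) *
        (lpSymbol φ (N⁻¹ • ξ) * ((((2 * Real.pi * ‖ξ‖) ^ s : ℝ) : ℂ) * K₀ ξ))))) q volume +
      eLpNorm (𝓕⁻ (fun ξ => ((N ^ (-s) : ℝ) : ℂ) *
        (waveSymbol β (t * N) (-(Real.pi / 2)) (N⁻¹ • ξ) *
        (lpSymbol φ (N⁻¹ • ξ) * ((((2 * Real.pi * ‖ξ‖) ^ (s - 1) : ℝ) : ℂ) * K₁ ξ))))) q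
          volume := by
  simp only [LPsymbol_mul_waveSymbol hφ hβ hN]
  have e₀ : ∀ ξ : E3, Real.cos (2 * Real.pi * t * ‖ξ‖ + 0) * (2 * Real.pi * ‖ξ‖) ^ (s - s) =
      Real.cos (2 * Real.pi * t * ‖ξ‖) := fun ξ => by simp
  have e₁ : ∀ ξ : E3, Real.cos (2 * Real.pi * t * ‖ξ‖ + -(Real.pi / 2)) *
      (2 * Real.pi * ‖ξ‖) ^ (s - 1 - s) =
      Real.sin (2 * Real.pi * t * ‖ξ‖) / (2 * Real.pi * ‖ξ‖) := fun ξ => by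
    rw [← sub_eq_add_neg, Real.cos_sub_pi_div_two, show s - 1 - s = -1 by ring, Real.rpow_neg_one,
      div_eq_mul_inv]
  simp only [e₀, e₁]
  have i₀ : Integrable fun ξ : E3 => ((Real.cos (2 * Real.pi * t * ‖ξ‖) : ℝ) : ℂ) * K₀ ξ :=
    integrable_ofReal_mul (by fun_prop) (fun ξ => Real.abs_cos_le_one _) K₀
  have i₁ : Integrable fun ξ : E3 =>
      ((Real.sin (2 * Real.pi * t * ‖ξ‖) / (2 * Real.pi * ‖ξ‖) : ℝ) : ℂ) * K₁ ξ :=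
    integrable_ofReal_mul (by fun_prop) (fun ξ => abs_sin_div_le t ‖ξ‖) K₁
  have hF : (fun x => cosProp3 t f₀ x + sinProp3 t f₁ x) = 𝓕⁻ (fun ξ : E3 =>
      ((Real.cos (2 * Real.pi * t * ‖ξ‖) : ℝ) : ℂ) * K₀ ξ +
      ((Real.sin (2 * Real.pi * t * ‖ξ‖) / (2 * Real.pi * ‖ξ‖) : ℝ) : ℂ) * K₁ ξ) := by
    rw [fourierInv_add i₀ i₁]
    simp only [cosProp3, sinProp3, fmul3, h₀, h₁]
    rfl
  have hc : ∀ ξ : E3, ξ ≠ 0 → ContinuousAt (fun ξ : E3 =>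
      ((Real.cos (2 * Real.pi * t * ‖ξ‖) : ℝ) : ℂ) * K₀ ξ +
      ((Real.sin (2 * Real.pi * t * ‖ξ‖) / (2 * Real.pi * ‖ξ‖) : ℝ) : ℂ) * K₁ ξ) ξ := by
    intro ξ hξ
    have hpos : 0 < ‖ξ‖ := norm_pos_iff.2 hξ
    have c₀ : Continuous fun ξ : E3 => ((Real.cos (2 * Real.pi * t * ‖ξ‖) : ℝ) : ℂ) := by fun_prop
    have c₁ : ContinuousAt (fun ξ : E3 =>
        Real.sin (2 * Real.pi * t * ‖ξ‖) / (2 * Real.pi * ‖ξ‖)) ξ :=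
      ContinuousAt.div (by fun_prop) (by fun_prop) (by positivity)
    exact (c₀.mul K₀.continuous).continuousAt.add
      ((Complex.continuous_ofReal.continuousAt.comp c₁).mul K₁.continuous.continuousAt)
  rw [hF]
  rcases hφ.LP3_fourierInv N (i₀.add i₁) hc with h | h
  · have j₀ := hφ.integrable_lpSymbol_mul N i₀
    have j₁ := hφ.integrable_lpSymbol_mul N i₁
    refine (le_of_eq ?_).trans (eLpNorm_add_le (continuous_fourierInv j₀).aestronglyMeasurable
      (continuous_fourierInv j₁).aestronglyMeasurable hq)
    rw [← fourierInv_add j₀ j₁]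
    refine congrArg (fun F => eLpNorm F q volume) (h.trans ?_)
    exact congrArg _ (funext fun ξ => mul_add _ _ _)
  · refine le_of_eq_of_le ?_ (zero_le (a := _))
    exact (congrArg (fun F => eLpNorm F q volume) h).trans eLpNorm_zero

lemma ENNReal.add_sq_le (x y : ℝ≥0∞) : (x + y) ^ 2 ≤ 2 * x ^ 2 + 2 * y ^ 2 := by
  have := ENNReal.rpow_add_le_mul_rpow_add_rpow x y one_le_two
  norm_num at this
  rwa [mul_add] at this

lemma sq_biSup_mul_le {ι : Type*} {S : Set ι} {w a b c : ι → ℝ≥0∞}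
    (h : ∀ t ∈ S, a t ≤ b t + c t) :
    (⨆ t ∈ S, w t * a t) ^ 2 ≤ 2 * (⨆ t ∈ S, w t * b t) ^ 2 + 2 * (⨆ t ∈ S, w t * c t) ^ 2 := by
  refine le_trans (pow_le_pow_left' (iSup₂_le fun t ht => ?_) 2) (ENNReal.add_sq_le _ _)
  calc w t * a t ≤ w t * b t + w t * c t := by
        rw [← mul_add]
        exact mul_le_mul_right (h t ht) _
    _ ≤ _ := add_le_add (le_iSup₂ (f := fun t (_ : t ∈ S) => w t * b t) t ht)
        (le_iSup₂ (f := fun t (_ : t ∈ S) => w t * c t) t ht)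

/-- **Linear-term bound in the weighted bootstrap norm, `L^p` version.** -/
theorem linear_term_bound_Lp (p : ℝ) (hp : 2 < p) (φ : E3 → ℝ) (hφ : IsLPBump3 φ) :
    ∃ C : ℝ≥0, ∀ (u₀ u₁ : 𝓢(E3, ℝ)),
      (∑' n : ℤ,
          (⨆ t ∈ Ici (0:ℝ),
            ENNReal.ofReal (((1 + t * (2:ℝ) ^ n) / (2:ℝ) ^ n) ^ (1 - 2 / p)) *
              eLpNorm
                (LP3 φ ((2:ℝ) ^ n)
                  (fun x => cosProp3 t (rc (⇑u₀)) x + sinProp3 t (rc (⇑u₁)) x))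
                (ENNReal.ofReal p) volume) ^ (2:ℕ)) ^ (1/2 : ℝ) ≤
        (C : ℝ≥0∞) *
          (eLpNorm (absGrad3 (2 - 4 / p) (rc (⇑u₀))) (ENNReal.ofReal (p / (p - 1))) volume +
           eLpNorm (absGrad3 (1 - 4 / p) (rc (⇑u₁))) (ENNReal.ofReal (p / (p - 1))) volume) := by
  have hp0 : 0 < p := by linarith
  have h4 : 0 < 4 / p := by positivity
  have h4' : 4 / p < 2 := by
    rw [div_lt_iff₀ hp0]
    linarith
  obtain ⟨β, hβ, hβ'⟩ := exists_annularBump (2 - 4 / p)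
  obtain ⟨C, hC⟩ := hφ.exists_tsum_le hβ hp
  refine ⟨NNReal.sqrt (2 * C), fun u₀ u₁ => ?_⟩
  obtain ⟨K₀, hK₀⟩ := exists_schwartz_fourier_rc u₀
  obtain ⟨K₁, hK₁⟩ := exists_schwartz_fourier_rc u₁
  have hs : (1 : ℝ) - 4 / p = 2 - 4 / p - 1 := by ring
  have b₀ := hC _ (integrable_rpow_norm_mul K₀ (σ := 2 - 4 / p) (by linarith) (by linarith))
    (fun ξ => contDiffAt_rpow_norm_mul K₀ _) 0
  have b₁ := hC _ (integrable_rpow_norm_mul K₁ (σ := 2 - 4 / p - 1) (by linarith) (by linarith))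
    (fun ξ => contDiffAt_rpow_norm_mul K₁ _) (-(Real.pi / 2))
  simp only [hs, absGrad3, fmul3, hK₀, hK₁]
  set E₀ := eLpNorm (𝓕⁻ fun ξ => (((2 * Real.pi * ‖ξ‖) ^ (2 - 4 / p) : ℝ) : ℂ) * K₀ ξ)
    (ENNReal.ofReal (p / (p - 1))) volume
  set E₁ := eLpNorm (𝓕⁻ fun ξ => (((2 * Real.pi * ‖ξ‖) ^ (2 - 4 / p - 1) : ℝ) : ℂ) * K₁ ξ)
    (ENNReal.ofReal (p / (p - 1))) volume
  have hsum : ∀ n : ℤ, (⨆ t ∈ Ici (0:ℝ),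
      ENNReal.ofReal (((1 + t * (2:ℝ) ^ n) / (2:ℝ) ^ n) ^ (1 - 2 / p)) *
        eLpNorm (LP3 φ ((2:ℝ) ^ n) (fun x => cosProp3 t (rc (⇑u₀)) x + sinProp3 t (rc (⇑u₁)) x))
          (ENNReal.ofReal p) volume) ^ 2 ≤ _ := fun n =>
    sq_biSup_mul_le fun t _ => hφ.eLpNorm_LP3_le hβ' (zpow_pos zero_lt_two n)
      (by rw [ENNReal.one_le_ofReal]; linarith) t hK₀ hK₁
  have htot := ENNReal.tsum_le_tsum hsum
  rw [ENNReal.tsum_add, ENNReal.tsum_mul_left, ENNReal.tsum_mul_left] at htot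
  have hfin := htot.trans (add_le_add (mul_le_mul_right b₀ 2) (mul_le_mul_right b₁ 2))
  have hle : 2 * (C * E₀ ^ 2) + 2 * (C * E₁ ^ 2) ≤
      ((NNReal.sqrt (2 * C) : ℝ≥0) * (E₀ + E₁) : ℝ≥0∞) ^ 2 := by
    rw [mul_pow, ← ENNReal.coe_pow, NNReal.sq_sqrt, ENNReal.coe_mul, ← mul_assoc, ← mul_assoc,
      ← mul_add]
    gcongr
    · norm_num
    · rw [add_sq, add_right_comm]
      exact le_self_add
  refine (ENNReal.rpow_le_rpow (hfin.trans hle) (by norm_num)).trans_eq ?_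
  rw [← ENNReal.rpow_natCast, ← ENNReal.rpow_mul]
  norm_num

end
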